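/- arXiv:2403.05708 — 2 statements merged into one kernel-verified Lean document; each statement's English description precedes it below -/
import Mathlib

section
/- Let σ* < c be real numbers and let f be meromorphic on an open neighbourhood of the closed vertical strip {s ∈ ℂ : σ* ≤ Re(s) ≤ c}, whose poles in this strip are exactly finitely many points p_1,…,p_r, all having the same real part λ ∈ (σ*, c), with respective orders m_1,…,m_r. Assume: (a) t ↦ f(σ*+it) and t ↦ f(c+it) are absolutely integrable on ℝ; (b) there exist sequences η_j → +∞ and ζ_j → +∞ such that sup_{σ∈[σ*,c]} |f(σ + i·η_j)| → 0 and sup_{σ∈[σ*,c]} |f(σ − i·ζ_j)| → 0 as j → ∞. Then there exist complex constants A_{k,i} (1 ≤ k ≤ r, 0 ≤ i ≤ m_k − 1) and M > 0 such that for every z > 0 the integral F(z) := ∫_{c+iℝ} f(s)·z^{−s} ds (i.e. i·∫_ℝ f(c+it)·z^{−(c+it)} dt) converges absolutely and | F(z) − Σ_{k=1}^r z^{−p_k} · Σ_{i=0}^{m_k−1} A_{k,i}·(log z)^i | ≤ M·z^{−σ*}. In particular, since λ > σ*, the finite sum gives the leading asymptotic behaviour of F(z) as z → 0⁺. -/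
open Complex Filter MeasureTheory Set

noncomputable section

open scoped Interval

/-- The counterclockwise integral of `F` over the boundary of the rectangle with real parts
between `x₁` and `x₂` and imaginary parts between `a` and `b`. -/
def rectIntegral (F : ℂ → ℂ) (x₁ x₂ a b : ℝ) : ℂ :=
  (∫ x : ℝ in x₁..x₂, F (x + a * I)) - (∫ x : ℝ in x₁..x₂, F (x + b * I)) +
    I * (∫ y : ℝ in a..b, F (x₂ + y * I)) - I * (∫ y : ℝ in a..b, F (x₁ + y * I))

/-- The boundary of the rectangle with real parts between `x₁` and `x₂` and imaginary parts
between `a` and `b`. -/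
def rectBoundary (x₁ x₂ a b : ℝ) : Set ℂ :=
  {s | s ∈ [[x₁, x₂]] ×ℂ [[a, b]] ∧ (s.re = x₁ ∨ s.re = x₂ ∨ s.im = a ∨ s.im = b)}

section RectIntegral

variable {F G : ℂ → ℂ} {x₁ x₂ a b : ℝ}

lemma horizontal_mem_rectBoundary {x y : ℝ} (hx : x ∈ [[x₁, x₂]]) (hy : y = a ∨ y = b) :
    (x + y * I : ℂ) ∈ rectBoundary x₁ x₂ a b := by
  refine ⟨?_, ?_⟩
  · rw [mem_reProdIm]
    rcases hy with rfl | rfl <;> simp [hx]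
  · rcases hy with rfl | rfl <;> simp

lemma vertical_mem_rectBoundary {x y : ℝ} (hy : y ∈ [[a, b]]) (hx : x = x₁ ∨ x = x₂) :
    (x + y * I : ℂ) ∈ rectBoundary x₁ x₂ a b := by
  refine ⟨?_, ?_⟩
  · rw [mem_reProdIm]
    rcases hx with rfl | rfl <;> simp [hy]
  · rcases hx with rfl | rfl <;> simp

lemma intervalIntegrable_horizontal {y : ℝ} (hF : ContinuousOn F (rectBoundary x₁ x₂ a b))
    (hy : y = a ∨ y = b) :
    IntervalIntegrable (fun x : ℝ => F (x + y * I)) volume x₁ x₂ :=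
  ContinuousOn.intervalIntegrable <| hF.comp (by fun_prop)
    fun _ hx => horizontal_mem_rectBoundary hx hy

lemma intervalIntegrable_vertical {x : ℝ} (hF : ContinuousOn F (rectBoundary x₁ x₂ a b))
    (hx : x = x₁ ∨ x = x₂) :
    IntervalIntegrable (fun y : ℝ => F (x + y * I)) volume a b :=
  ContinuousOn.intervalIntegrable <| hF.comp (by fun_prop)
    fun _ hy => vertical_mem_rectBoundary hy hx

lemma rectIntegral_congr (h : EqOn F G (rectBoundary x₁ x₂ a b)) :
    rectIntegral F x₁ x₂ a b = rectIntegral G x₁ x₂ a b := by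
  unfold rectIntegral
  congr 1
  · congr 1
    · congr 1
      · exact intervalIntegral.integral_congr fun x hx =>
          h (horizontal_mem_rectBoundary hx (.inl rfl))
      · exact intervalIntegral.integral_congr fun x hx =>
          h (horizontal_mem_rectBoundary hx (.inr rfl))
    · congr 1
      exact intervalIntegral.integral_congr fun x hx =>
        h (vertical_mem_rectBoundary hx (.inr rfl))
  · congr 1
    exact intervalIntegral.integral_congr fun x hx =>
      h (vertical_mem_rectBoundary hx (.inl rfl))

lemma rectIntegral_add (hF : ContinuousOn F (rectBoundary x₁ x₂ a b))
    (hG : ContinuousOn G (rectBoundary x₁ x₂ a b)) :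
    rectIntegral (fun s => F s + G s) x₁ x₂ a b =
      rectIntegral F x₁ x₂ a b + rectIntegral G x₁ x₂ a b := by
  unfold rectIntegral
  rw [intervalIntegral.integral_add (intervalIntegrable_horizontal hF (.inl rfl))
      (intervalIntegrable_horizontal hG (.inl rfl)),
    intervalIntegral.integral_add (intervalIntegrable_horizontal hF (.inr rfl))
      (intervalIntegrable_horizontal hG (.inr rfl)),
    intervalIntegral.integral_add (intervalIntegrable_vertical hF (.inl rfl))
      (intervalIntegrable_vertical hG (.inl rfl)),
    intervalIntegral.integral_add (intervalIntegrable_vertical hF (.inr rfl))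
      (intervalIntegrable_vertical hG (.inr rfl))]
  ring

lemma rectIntegral_const_mul (k : ℂ) :
    rectIntegral (fun s => k * F s) x₁ x₂ a b = k * rectIntegral F x₁ x₂ a b := by
  simp only [rectIntegral, intervalIntegral.integral_const_mul]
  ring

lemma rectIntegral_sum {ι : Type*} (S : Finset ι) {F : ι → ℂ → ℂ}
    (hF : ∀ i ∈ S, ContinuousOn (F i) (rectBoundary x₁ x₂ a b)) :
    rectIntegral (fun s => ∑ i ∈ S, F i s) x₁ x₂ a b =
      ∑ i ∈ S, rectIntegral (F i) x₁ x₂ a b := by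
  classical
  induction S using Finset.induction_on with
  | empty => simp [rectIntegral]
  | insert i S hi ih =>
    simp only [Finset.sum_insert hi]
    rw [rectIntegral_add (hF i (by simp))
      (continuousOn_finsetSum S fun j hj => hF j (by simp [hj])),
      ih fun j hj => hF j (by simp [hj])]

lemma rectIntegral_eq_zero_of_differentiableOn
    (hF : DifferentiableOn ℂ F ([[x₁, x₂]] ×ℂ [[a, b]])) : rectIntegral F x₁ x₂ a b = 0 := by
  simpa [rectIntegral] using
    integral_boundary_rect_eq_zero_of_differentiableOn F ⟨x₁, a⟩ ⟨x₂, b⟩ hF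

lemma rectIntegral_eq_zero_of_hasDerivAt
    (hF : ∀ s ∈ rectBoundary x₁ x₂ a b, HasDerivAt F (G s) s)
    (hG : ContinuousOn G (rectBoundary x₁ x₂ a b)) : rectIntegral G x₁ x₂ a b = 0 := by
  have horiz : ∀ y, y = a ∨ y = b →
      ∫ x : ℝ in x₁..x₂, G (x + y * I) = F (x₂ + y * I) - F (x₁ + y * I) := fun y hy =>
    intervalIntegral.integral_eq_sub_of_hasDerivAt (f := fun x : ℝ => F (x + y * I))
      (fun x hx => by
        have h : HasDerivAt (fun x : ℝ => (x + y * I : ℂ)) 1 x :=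
          Complex.ofRealCLM.hasDerivAt.add_const _
        have h' := (hF _ (horizontal_mem_rectBoundary hx hy)).comp x h
        rw [mul_one] at h'
        exact h')
      (intervalIntegrable_horizontal hG hy)
  have vert : ∀ x, x = x₁ ∨ x = x₂ →
      I * ∫ y : ℝ in a..b, G (x + y * I) = F (x + b * I) - F (x + a * I) := fun x hx => by
    rw [← intervalIntegral.integral_const_mul]
    exact intervalIntegral.integral_eq_sub_of_hasDerivAt (f := fun y : ℝ => F (x + y * I))
      (fun y hy => by
        have h : HasDerivAt (fun y : ℝ => (x + y * I : ℂ)) I y := by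
          simpa using (Complex.ofRealCLM.hasDerivAt.mul_const I).const_add (x : ℂ)
        have h' := (hF _ (vertical_mem_rectBoundary hy hx)).comp y h
        rw [mul_comm] at h'
        exact h')
      ((intervalIntegrable_vertical hG hx).const_mul I)
  rw [rectIntegral, horiz a (.inl rfl), horiz b (.inr rfl), vert x₁ (.inl rfl),
    vert x₂ (.inr rfl)]
  ring

lemma rectIntegral_add_adjacent (h₁ : Integrable (fun t : ℝ => F (x₁ + t * I)))
    (h₂ : Integrable (fun t : ℝ => F (x₂ + t * I))) (d : ℝ) :
    rectIntegral F x₁ x₂ a b + rectIntegral F x₁ x₂ b d = rectIntegral F x₁ x₂ a d := by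
  unfold rectIntegral
  rw [← intervalIntegral.integral_add_adjacent_intervals (a := a) (b := b) (c := d)
      h₁.intervalIntegrable h₁.intervalIntegrable,
    ← intervalIntegral.integral_add_adjacent_intervals (a := a) (b := b) (c := d)
      h₂.intervalIntegrable h₂.intervalIntegrable]
  ring

lemma continuousOn_inv_sub_pow {p : ℂ} {S : Set ℂ} (hp : p ∉ S) (n : ℕ) :
    ContinuousOn (fun s => ((s - p) ^ n)⁻¹) S :=
  ContinuousOn.inv₀ (by fun_prop) fun s hs =>
    pow_ne_zero _ (sub_ne_zero.2 fun h => hp (h ▸ hs))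

lemma rectIntegral_exp_mul_inv_pow {p : ℂ} (hp : p ∉ rectBoundary x₁ x₂ a b) (L : ℂ) (n : ℕ) :
    rectIntegral (fun s => exp (-(s * L)) * ((s - p) ^ (n + 1))⁻¹) x₁ x₂ a b =
      exp (-(p * L)) * ((-L) ^ n / n.factorial) *
        rectIntegral (fun s => (s - p)⁻¹) x₁ x₂ a b := by
  have hne : ∀ s ∈ rectBoundary x₁ x₂ a b, s - p ≠ 0 := fun s hs =>
    sub_ne_zero.2 fun h => hp (h ▸ hs)
  have hcont : ∀ n, ContinuousOn (fun s => exp (-(s * L)) * ((s - p) ^ n)⁻¹)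
      (rectBoundary x₁ x₂ a b) := fun n =>
    ContinuousOn.mul (by fun_prop) (continuousOn_inv_sub_pow hp n)
  induction n with
  | zero =>
    have hd : Differentiable ℂ (dslope (fun s => exp (-(s * L))) p) := by
      rw [← differentiableOn_univ, Complex.differentiableOn_dslope Filter.univ_mem]
      fun_prop
    have hsplit : EqOn (fun s => exp (-(s * L)) * ((s - p) ^ (0 + 1))⁻¹)
        (fun s => exp (-(p * L)) * (s - p)⁻¹ + dslope (fun s => exp (-(s * L))) p s)
        (rectBoundary x₁ x₂ a b) := fun s hs => by
      have h := sub_smul_dslope (fun s => exp (-(s * L))) p s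
      have h' := hne s hs
      simp only [smul_eq_mul] at h
      simp only [zero_add, pow_one]
      rw [← sub_eq_iff_eq_add', ← sub_mul, ← h, mul_right_comm, mul_inv_cancel₀ h', one_mul]
    rw [rectIntegral_congr hsplit, rectIntegral_add
      (continuousOn_const.fun_mul (by simpa using continuousOn_inv_sub_pow hp 1))
      hd.continuous.continuousOn, rectIntegral_const_mul,
      rectIntegral_eq_zero_of_differentiableOn hd.differentiableOn]
    simp
  | succ n ih =>
    have hzero : rectIntegral (fun s => -L * (exp (-(s * L)) * ((s - p) ^ (n + 1))⁻¹) +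
        -(n + 1 : ℂ) * (exp (-(s * L)) * ((s - p) ^ (n + 1 + 1))⁻¹)) x₁ x₂ a b = 0 := by
      refine rectIntegral_eq_zero_of_hasDerivAt
        (F := fun s => exp (-(s * L)) * ((s - p) ^ (n + 1))⁻¹) (fun s hs => ?_)
        ((continuousOn_const.fun_mul (hcont _)).fun_add (continuousOn_const.fun_mul (hcont _)))
      have h₁ : HasDerivAt (fun s => exp (-(s * L))) (exp (-(s * L)) * -(1 * L)) s :=
        ((hasDerivAt_id s).mul_const L).neg.cexp
      have h₂ := (((hasDerivAt_id s).sub_const p).pow (n + 1)).inv (pow_ne_zero _ (hne s hs))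
      convert! h₁.mul h₂ using 1
      have h' := hne s hs
      simp
      field_simp
      ring
    rw [rectIntegral_add (continuousOn_const.fun_mul (hcont _)) (continuousOn_const.fun_mul (hcont _)),
      rectIntegral_const_mul, rectIntegral_const_mul, ih] at hzero
    have hn : (n + 1 : ℂ) ≠ 0 := by exact_mod_cast n.succ_ne_zero
    refine mul_left_cancel₀ hn ?_
    have hfac : (n.factorial : ℂ) ≠ 0 := by exact_mod_cast n.factorial_ne_zero
    rw [Nat.factorial_succ]
    push_cast
    generalize rectIntegral _ x₁ x₂ a b = W at hzero ⊢
    generalize rectIntegral _ x₁ x₂ a b = R at hzero ⊢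
    have hdiv : (n + 1 : ℂ) * ((-L) ^ (n + 1) / ((n + 1) * n.factorial)) =
        -L * ((-L) ^ n / n.factorial) := by
      field_simp
      ring
    linear_combination -hzero - exp (-(p * L)) * W * hdiv

end RectIntegral

lemma AnalyticAt.dslope_same {g : ℂ → ℂ} {p : ℂ} (hg : AnalyticAt ℂ g p) :
    AnalyticAt ℂ (dslope g p) p := by
  obtain ⟨S, hS, hgS⟩ := hg.eventually_analyticAt.exists_mem
  exact ((Complex.differentiableOn_dslope hS).2 fun s hs =>
    (hgS s hs).differentiableAt.differentiableWithinAt).analyticAt hS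

/-- Splitting a quotient `g s / (s - p) ^ m` into its principal part and an analytic part. -/
lemma AnalyticAt.exists_principalPart {p : ℂ} (m : ℕ) :
    ∀ {g : ℂ → ℂ}, AnalyticAt ℂ g p → ∃ (b : ℕ → ℂ) (G : ℂ → ℂ), AnalyticAt ℂ G p ∧
      ∀ s ≠ p, g s / (s - p) ^ m =
        ∑ i ∈ Finset.range m, b i * ((s - p) ^ (i + 1))⁻¹ + G s := by
  induction m with
  | zero => exact fun {g} hg => ⟨0, g, hg, by simp⟩
  | succ m ih =>
    intro g hg
    obtain ⟨b, G, hG, hb⟩ := ih hg.dslope_same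
    refine ⟨fun i => if i = m then g p else b i, G, hG, fun s hs => ?_⟩
    have hsum : ∑ i ∈ Finset.range m, (if i = m then g p else b i) * ((s - p) ^ (i + 1))⁻¹ =
        ∑ i ∈ Finset.range m, b i * ((s - p) ^ (i + 1))⁻¹ :=
      Finset.sum_congr rfl fun i hi => by rw [if_neg (Finset.mem_range.1 hi).ne]
    have h := sub_smul_dslope g p s
    have h' : s - p ≠ 0 := sub_ne_zero.2 hs
    rw [Finset.sum_range_succ, hsum, add_right_comm, ← hb s hs]
    have hgs : g s = (s - p) * dslope g p s + g p := by
      rw [← smul_eq_mul, h, sub_add_cancel]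
    simp only [hgs, if_true, pow_succ]
    field_simp

/-- A function with finitely many removable singularities extends holomorphically. -/
lemma exists_differentiableOn_extension {U S : Set ℂ} (hU : IsOpen U) (hS : S.Finite)
    {h : ℂ → ℂ} (hd : DifferentiableOn ℂ h (U \ S))
    (hrem : ∀ p ∈ S, ∃ G : ℂ → ℂ, AnalyticAt ℂ G p ∧ h =ᶠ[nhdsWithin p {p}ᶜ] G) :
    ∃ H : ℂ → ℂ, DifferentiableOn ℂ H U ∧ ∀ s ∉ S, H s = h s := by
  classical
  choose! G hG hhG using hrem
  refine ⟨fun s => if s ∈ S then G s s else h s, fun p hp => ?_, fun s hs => if_neg hs⟩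
  refine DifferentiableAt.differentiableWithinAt ?_
  by_cases hpS : p ∈ S
  · refine (hG p hpS).differentiableAt.congr_of_eventuallyEq ?_
    have hS' : ∀ᶠ s in nhds p, s ∉ S \ {p} :=
      (hS.subset sdiff_subset).isClosed.isOpen_compl.mem_nhds (by simp)
    filter_upwards [hS', eventually_nhdsWithin_iff.1 (hhG p hpS)] with s hs hs'
    by_cases hsp : s = p
    · simp [hsp, hpS]
    · have hsS : s ∉ S := fun h => hs ⟨h, hsp⟩
      simp only [if_neg hsS]
      exact hs' hsp
  · have hmem : U \ S ∈ nhds p := (hU.sdiff hS.isClosed).mem_nhds ⟨hp, hpS⟩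
    refine (hd.differentiableAt hmem).congr_of_eventuallyEq ?_
    filter_upwards [hmem] with s hs using if_neg hs.2

/-- Shape of the residue sum of `f s * exp (-(s * L))` over a rectangle, as a function of `L`. -/
lemma exists_rectIntegral_mul_exp_eq {x₁ x₂ a b : ℝ} {U : Set ℂ} (hU : IsOpen U)
    (hsub : [[x₁, x₂]] ×ℂ [[a, b]] ⊆ U) {f : ℂ → ℂ} {r : ℕ} {P : Fin r → ℂ} {m : Fin r → ℕ}
    (hinj : Function.Injective P) (hP : ∀ k, P k ∉ rectBoundary x₁ x₂ a b)
    (hf : DifferentiableOn ℂ f (U \ range P))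
    (hpole : ∀ k, ∃ g : ℂ → ℂ, AnalyticAt ℂ g (P k) ∧
      ∀ᶠ s in nhdsWithin (P k) {P k}ᶜ, f s = g s / (s - P k) ^ m k) :
    ∃ A : Fin r → ℕ → ℂ, ∀ L : ℂ,
      rectIntegral (fun s => f s * exp (-(s * L))) x₁ x₂ a b =
        ∑ k, exp (-(P k * L)) * ∑ i ∈ Finset.range (m k), A k i * L ^ i := by
  have hpart : ∀ k, ∃ (β : ℕ → ℂ) (G : ℂ → ℂ), AnalyticAt ℂ G (P k) ∧
      ∀ᶠ s in nhdsWithin (P k) {P k}ᶜ,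
        f s = ∑ i ∈ Finset.range (m k), β i * ((s - P k) ^ (i + 1))⁻¹ + G s := fun k => by
    obtain ⟨g, hg, hfg⟩ := hpole k
    obtain ⟨β, G, hG, hβ⟩ := hg.exists_principalPart (m k)
    refine ⟨β, G, hG, ?_⟩
    filter_upwards [hfg, self_mem_nhdsWithin] with s hs hsp
    rw [hs, hβ s hsp]
  choose β G hG hfG using hpart
  set Q : Fin r → ℂ → ℂ := fun k s =>
    ∑ i ∈ Finset.range (m k), β k i * ((s - P k) ^ (i + 1))⁻¹ with hQ
  have hQd : ∀ k s, s ≠ P k → AnalyticAt ℂ (Q k) s := fun k s hs => by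
    refine Finset.analyticAt_fun_sum _ fun i _ => analyticAt_const.mul ?_
    exact AnalyticAt.inv (by fun_prop) (pow_ne_zero _ (sub_ne_zero.2 hs))
  obtain ⟨H, hH, hHf⟩ := exists_differentiableOn_extension (h := fun s => f s - ∑ k, Q k s) hU
    (finite_range P)
    (hf.sub fun s hs => (Finset.analyticAt_fun_sum _ fun k _ => hQd k s fun h =>
      hs.2 ⟨k, h.symm⟩).differentiableAt.differentiableWithinAt) (by
    classical
    rintro _ ⟨k, rfl⟩
    refine ⟨fun s => G k s - ∑ j ∈ Finset.univ.erase k, Q j s,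
      (hG k).sub (Finset.analyticAt_fun_sum _ fun j hj => hQd j _ fun h =>
        (Finset.ne_of_mem_erase hj) (hinj h).symm), ?_⟩
    filter_upwards [hfG k] with s hs
    rw [← Finset.add_sum_erase _ _ (Finset.mem_univ k), hs]
    simp only [hQ]
    ring)
  set w : Fin r → ℂ := fun k => rectIntegral (fun s => (s - P k)⁻¹) x₁ x₂ a b
  refine ⟨fun k i => β k i * ((-1) ^ i / i.factorial) * w k, fun L => ?_⟩
  have hsplit : EqOn (fun s => f s * exp (-(s * L)))
      (fun s => H s * exp (-(s * L)) + ∑ k, ∑ i ∈ Finset.range (m k),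
        β k i * (exp (-(s * L)) * ((s - P k) ^ (i + 1))⁻¹)) (rectBoundary x₁ x₂ a b) := by
    intro s hs
    have hsP : s ∉ range P := by
      rintro ⟨k, rfl⟩
      exact hP k hs
    have hQs : ∑ k, ∑ i ∈ Finset.range (m k),
        β k i * (exp (-(s * L)) * ((s - P k) ^ (i + 1))⁻¹) = (∑ k, Q k s) * exp (-(s * L)) := by
      simp only [hQ, Finset.sum_mul]
      exact Finset.sum_congr rfl fun k _ => Finset.sum_congr rfl fun i _ => by ring
    simp only [hQs, hHf s hsP]
    ring
  have hterm : ∀ k i, ContinuousOn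
      (fun s => β k i * (exp (-(s * L)) * ((s - P k) ^ (i + 1))⁻¹)) (rectBoundary x₁ x₂ a b) :=
    fun k i => continuousOn_const.fun_mul
      (ContinuousOn.mul (by fun_prop) (continuousOn_inv_sub_pow (hP k) _))
  have hHe : DifferentiableOn ℂ (fun s => H s * exp (-(s * L))) ([[x₁, x₂]] ×ℂ [[a, b]]) :=
    (hH.mono hsub).mul (by fun_prop)
  rw [rectIntegral_congr hsplit, rectIntegral_add
    (hHe.continuousOn.mono fun s hs => hs.1)
    (continuousOn_finsetSum _ fun k _ => continuousOn_finsetSum _ fun i _ => hterm k i),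
    rectIntegral_eq_zero_of_differentiableOn hHe, zero_add,
    rectIntegral_sum _ fun k _ => continuousOn_finsetSum _ fun i _ => hterm k i]
  refine Finset.sum_congr rfl fun k _ => ?_
  rw [rectIntegral_sum _ fun i _ => hterm k i, Finset.mul_sum]
  refine Finset.sum_congr rfl fun i _ => ?_
  rw [rectIntegral_const_mul, rectIntegral_exp_mul_inv_pow (hP k), neg_pow L i]
  ring

lemma norm_exp_neg_mul_ofReal (x y L : ℝ) :
    ‖exp (-((x + y * I) * L))‖ = Real.exp (-(x * L)) := by
  simp [Complex.norm_exp]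

lemma integrable_mul_exp_vertical {f : ℂ → ℂ} {x : ℝ}
    (hf : Integrable (fun t : ℝ => f (x + t * I))) (L : ℝ) :
    Integrable (fun t : ℝ => f (x + t * I) * exp (-((x + t * I) * L))) :=
  hf.mul_bdd (c := Real.exp (-(x * L))) (Continuous.aestronglyMeasurable (by fun_prop))
    (ae_of_all _ fun t => (norm_exp_neg_mul_ofReal x t L).le)

lemma norm_integral_mul_exp_vertical_le (f : ℂ → ℂ) (x L : ℝ) :
    ‖∫ t : ℝ, f (x + t * I) * exp (-((x + t * I) * L))‖ ≤
      (∫ t : ℝ, ‖f (x + t * I)‖) * Real.exp (-(x * L)) := by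
  refine (norm_integral_le_integral_norm _).trans_eq ?_
  simp only [norm_mul, norm_exp_neg_mul_ofReal, integral_mul_const]

lemma tendsto_integral_mul_exp_horizontal {f : ℂ → ℂ} {x₁ x₂ : ℝ} (hx : x₁ ≤ x₂) {τ u : ℕ → ℝ}
    (hu : Tendsto u atTop (nhds 0))
    (hfu : ∀ j, ∀ x ∈ Icc x₁ x₂, ‖f ((x : ℂ) + (τ j : ℂ) * I)‖ ≤ u j) (L : ℝ) :
    Tendsto (fun j => ∫ x : ℝ in x₁..x₂, f (x + τ j * I) * exp (-((x + τ j * I) * L)))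
      atTop (nhds 0) := by
  obtain ⟨B, hB⟩ := (isCompact_Icc (a := x₁) (b := x₂)).exists_bound_of_continuousOn
    (f := fun x : ℝ => Real.exp (-(x * L))) (by fun_prop)
  refine squeeze_zero_norm (a := fun j => u j * B * |x₂ - x₁|) (fun j => ?_)
    (by simpa using (hu.mul_const B).mul_const |x₂ - x₁|)
  refine intervalIntegral.norm_integral_le_of_norm_le_const fun x hx' => ?_
  have hxI : x ∈ Icc x₁ x₂ := by
    rw [uIoc_of_le hx] at hx'
    exact Ioc_subset_Icc_self hx'
  have h := hB x hxI
  rw [norm_mul, norm_exp_neg_mul_ofReal]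
  rw [Real.norm_of_nonneg (Real.exp_pos _).le] at h
  exact mul_le_mul (hfu j x hxI) h (Real.exp_pos _).le ((norm_nonneg _).trans (hfu j x hxI))

/-- If `F` is holomorphic on the strip outside a rectangle of height `2 * T`, is integrable along
the edges of the strip, and has vanishing integrals along horizontal segments, then its integral
over the boundary of the rectangle is the difference of the integrals over the two edges. -/
lemma rectIntegral_eq_sub_integral_vertical {F : ℂ → ℂ} {x₁ x₂ T : ℝ} {η ζ : ℕ → ℝ}
    (hF : ∀ s : ℂ, s.re ∈ [[x₁, x₂]] → s.im ∉ Ioo (-T) T → DifferentiableAt ℂ F s)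
    (h₁ : Integrable (fun t : ℝ => F (x₁ + t * I)))
    (h₂ : Integrable (fun t : ℝ => F (x₂ + t * I)))
    (hη : Tendsto η atTop atTop) (hζ : Tendsto ζ atTop atBot)
    (hFη : Tendsto (fun j => ∫ x : ℝ in x₁..x₂, F (x + η j * I)) atTop (nhds 0))
    (hFζ : Tendsto (fun j => ∫ x : ℝ in x₁..x₂, F (x + ζ j * I)) atTop (nhds 0)) :
    rectIntegral F x₁ x₂ (-T) T =
      I * (∫ t : ℝ, F (x₂ + t * I)) - I * ∫ t : ℝ, F (x₁ + t * I) := by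
  have hlim : Tendsto (fun j => rectIntegral F x₁ x₂ (ζ j) (η j)) atTop
      (nhds (I * (∫ t : ℝ, F (x₂ + t * I)) - I * ∫ t : ℝ, F (x₁ + t * I))) := by
    have h := ((hFζ.sub hFη).add
      ((intervalIntegral_tendsto_integral h₂ hζ hη).const_mul I)).sub
      ((intervalIntegral_tendsto_integral h₁ hζ hη).const_mul I)
    simpa only [rectIntegral, sub_zero, zero_add] using h
  refine tendsto_nhds_unique (tendsto_const_nhds.congr' ?_) hlim
  filter_upwards [hη.eventually_ge_atTop T, hζ.eventually_le_atBot (-T)] with j hj hj'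
  have hup : DifferentiableOn ℂ F ([[x₁, x₂]] ×ℂ [[T, η j]]) := fun s hs => by
    rw [mem_reProdIm, uIcc_of_le hj] at hs
    exact (hF s hs.1 fun h => h.2.not_ge hs.2.1).differentiableWithinAt
  have hdown : DifferentiableOn ℂ F ([[x₁, x₂]] ×ℂ [[ζ j, -T]]) := fun s hs => by
    rw [mem_reProdIm, uIcc_of_le hj'] at hs
    exact (hF s hs.1 fun h => h.1.not_ge hs.2.2).differentiableWithinAt
  rw [← rectIntegral_add_adjacent (a := ζ j) (b := T) h₁ h₂,
    ← rectIntegral_add_adjacent (a := ζ j) (b := -T) h₁ h₂,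
    rectIntegral_eq_zero_of_differentiableOn hup,
    rectIntegral_eq_zero_of_differentiableOn hdown, zero_add, add_zero]

/-- Residue expansion / small-`z` asymptotics for a Mellin–Barnes integral over a
vertical line, with poles on a single vertical line inside the strip. -/
theorem mellinBarnes_small_z_asymptotics (σstar c : ℝ) (hσc : σstar < c)
    (U : Set ℂ) (hU : IsOpen U)
    (hUsub : {s : ℂ | σstar ≤ s.re ∧ s.re ≤ c} ⊆ U)
    (f : ℂ → ℂ) (r : ℕ) (P : Fin r → ℂ) (mOrd : Fin r → ℕ) (lam : ℝ)
    (hinj : Function.Injective P)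
    (hlam1 : σstar < lam) (hlam2 : lam < c)
    (hPre : ∀ k, (P k).re = lam)
    (hord : ∀ k, 1 ≤ mOrd k)
    (hf : AnalyticOn ℂ f (U \ Set.range P))
    (hpole : ∀ k, ∃ g : ℂ → ℂ, AnalyticAt ℂ g (P k) ∧ g (P k) ≠ 0 ∧
      ∀ᶠ s in nhdsWithin (P k) {P k}ᶜ, f s = g s / (s - P k) ^ (mOrd k))
    (hint1 : MeasureTheory.Integrable (fun t : ℝ => f (σstar + t * Complex.I)))
    (hint2 : MeasureTheory.Integrable (fun t : ℝ => f (c + t * Complex.I)))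
    (hup : ∃ η : ℕ → ℝ, ∃ u : ℕ → ℝ, Tendsto η atTop atTop ∧ Tendsto u atTop (nhds 0) ∧
      ∀ j, ∀ σ ∈ Set.Icc σstar c, ‖f ((σ : ℂ) + (η j : ℂ) * Complex.I)‖ ≤ u j)
    (hdown : ∃ ζ : ℕ → ℝ, ∃ u : ℕ → ℝ, Tendsto ζ atTop atTop ∧ Tendsto u atTop (nhds 0) ∧
      ∀ j, ∀ σ ∈ Set.Icc σstar c, ‖f ((σ : ℂ) - (ζ j : ℂ) * Complex.I)‖ ≤ u j) :
    ∃ A : Fin r → ℕ → ℂ, ∃ M : ℝ, 0 < M ∧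
      ∀ z : ℝ, 0 < z →
        MeasureTheory.Integrable (fun t : ℝ => f (c + t * Complex.I) *
          Complex.exp (-((c + t * Complex.I) * Real.log z))) ∧
        ‖(Complex.I * ∫ t : ℝ, f (c + t * Complex.I) *
              Complex.exp (-((c + t * Complex.I) * Real.log z)))
            - ∑ k : Fin r, Complex.exp (-(P k * Real.log z)) *
                ∑ i ∈ Finset.range (mOrd k), A k i * (Real.log z : ℂ) ^ i‖
          ≤ M * z ^ (-σstar) := by
  have hlam : ∀ k, σstar < (P k).re ∧ (P k).re < c := fun k => by
    rw [hPre k]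
    exact ⟨hlam1, hlam2⟩
  have hfd : DifferentiableOn ℂ f (U \ range P) := hf.differentiableOn
  have hopen : IsOpen (U \ range P) := hU.sdiff (finite_range P).isClosed
  set T : ℝ := 1 + ∑ k, |(P k).im| with hT
  have hPT : ∀ k, (P k).im ∈ Ioo (-T) T := fun k => by
    have h := Finset.single_le_sum (f := fun k => |(P k).im|) (fun k _ => abs_nonneg _)
      (Finset.mem_univ k)
    exact abs_lt.1 (by linarith)
  have hPb : ∀ k, P k ∉ rectBoundary σstar c (-T) T := fun k hk => by
    rcases hk.2 with h | h | h | h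
    · exact (hlam k).1.ne' h
    · exact (hlam k).2.ne h
    · exact (hPT k).1.ne' h
    · exact (hPT k).2.ne h
  obtain ⟨A, hA⟩ := exists_rectIntegral_mul_exp_eq (x₁ := σstar) (x₂ := c) (a := -T) (b := T) hU
    (fun s hs => hUsub (by rw [mem_reProdIm, uIcc_of_le hσc.le] at hs; exact hs.1)) hinj hPb hfd
    fun k => (hpole k).imp fun g hg => ⟨hg.1, hg.2.2⟩
  obtain ⟨η, u, hη, hu, hfu⟩ := hup
  obtain ⟨ζ, v, hζ, hv, hfv⟩ := hdown
  refine ⟨A, (∫ t : ℝ, ‖f (σstar + t * I)‖) + 1, ?_, fun z hz => ?_⟩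
  · have : 0 ≤ ∫ t : ℝ, ‖f (σstar + t * I)‖ := integral_nonneg fun _ => norm_nonneg _
    linarith
  refine ⟨integrable_mul_exp_vertical hint2 _, ?_⟩
  have hrect := rectIntegral_eq_sub_integral_vertical (T := T) (ζ := fun j => -ζ j)
    (F := fun s => f s * exp (-(s * Real.log z)))
    (fun s hs hsT => by
      rw [uIcc_of_le hσc.le] at hs
      have hmem : s ∈ U \ range P := ⟨hUsub hs, by
        rintro ⟨k, rfl⟩
        exact hsT (hPT k)⟩
      exact (hfd.differentiableAt (hopen.mem_nhds hmem)).fun_mul (by fun_prop))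
    (integrable_mul_exp_vertical hint1 _) (integrable_mul_exp_vertical hint2 _) hη
    (tendsto_neg_atTop_atBot.comp hζ)
    (tendsto_integral_mul_exp_horizontal hσc.le hu hfu _)
    (tendsto_integral_mul_exp_horizontal hσc.le hv (fun j x hx => by
      simpa [← sub_eq_add_neg] using hfv j x hx) _)
  rw [← hA, hrect, sub_sub_cancel, norm_mul, norm_I, one_mul]
  have hexp : Real.exp (-(σstar * Real.log z)) = z ^ (-σstar) := by
    rw [Real.rpow_def_of_pos hz]
    ring_nf
  refine (norm_integral_mul_exp_vertical_le f σstar _).trans ?_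
  rw [hexp]
  exact mul_le_mul_of_nonneg_right (by linarith) (Real.rpow_nonneg hz.le _)
end
end

section
/- Let τ > 0, α ∈ ℂ, and let m ≤ q, n ≤ p be nonnegative integers with m < q, a ∈ ℂ^p, b ∈ ℂ^q with λ♯ < λ♭, and suppose that either N > 0, or N = 0 and Re(α) > 0. Let p_1,…,p_r (possibly r = 0) be the poles of the meromorphic function s ↦ 𝒢^{m,n}_{p,q}(a;b|s;τ) whose real part equals λ♯ (these lie in the finite set {b_j − τ − 1 : m+1 ≤ j ≤ q, Re(b_j) = λ♯ + τ + 1}), and let m_k be the order of the pole p_k. Then there exist δ > 0, complex constants A_{k,i} (1 ≤ k ≤ r, 0 ≤ i ≤ m_k − 1) and M > 0 such that for every z ∈ (0,1]: | K^{m,n}_{p,q}(a;b|z;τ,α) − Σ_{k=1}^r z^{−p_k} · Σ_{i=0}^{m_k−1} A_{k,i}·(log z)^i | ≤ M·z^{−λ♯+δ}. -/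
open Complex Filter MeasureTheory Set

noncomputable section

/-- The digamma function ψ = Γ'/Γ. -/
def digammaC (z : ℂ) : ℂ := deriv Complex.Gamma z / Complex.Gamma z

/-- The gamma modular form C(τ). -/
def gammaModC (τ : ℂ) : ℂ :=
  limUnder atTop fun M : ℕ =>
    (∑ k ∈ Finset.Ico 1 M, digammaC (k * τ)) + digammaC (M * τ) / 2
      - (1 / τ) * Complex.log (Complex.Gamma (M * τ) / (Real.sqrt (2 * Real.pi) : ℂ))

/-- The gamma modular form D(τ). -/
def gammaModD (τ : ℂ) : ℂ :=
  limUnder atTop fun M : ℕ =>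
    (∑ k ∈ Finset.Ico 1 M, deriv digammaC (k * τ)) + deriv digammaC (M * τ) / 2
      - (1 / τ) * digammaC (M * τ)

def aBarnes (τ : ℂ) : ℂ :=
  -(Real.eulerMascheroniConstant : ℂ) * τ + (τ / 2) * Complex.log (2 * Real.pi * τ)
    + (1 / 2) * Complex.log τ - τ * gammaModC τ

def bBarnes (τ : ℂ) : ℂ :=
  -(Real.pi : ℂ) ^ 2 * τ ^ 2 / 6 - τ * Complex.log τ - τ ^ 2 * gammaModD τ

/-- The Barnes double gamma function `G(z;τ)`, via its Weierstrass product. -/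
def barnesG (z τ : ℂ) : ℂ :=
  z / τ * Complex.exp (aBarnes τ * z / τ + bBarnes τ * z ^ 2 / (2 * τ)) *
    ∏' mn : ℕ × ℕ,
      if mn = (0, 0) then 1
      else (1 + z / (mn.1 * τ + mn.2)) *
        Complex.exp (-(z / (mn.1 * τ + mn.2)) + z ^ 2 / (2 * ((mn.1 : ℂ) * τ + (mn.2 : ℂ)) ^ 2))

/-- The ratio of Barnes double gamma functions `𝒢^{m,n}_{p,q}(a;b | s;τ)`. -/
def calG (m n : ℕ) {p q : ℕ} (a : Fin p → ℂ) (b : Fin q → ℂ) (s τ : ℂ) : ℂ :=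
  ((∏ j : Fin q, if (j : ℕ) < m then barnesG (b j - s) τ else 1) *
      ∏ j : Fin p, if (j : ℕ) < n then barnesG (1 + τ - a j + s) τ else 1) /
    ((∏ j : Fin q, if m ≤ (j : ℕ) then barnesG (1 + τ - b j + s) τ else 1) *
      ∏ j : Fin p, if n ≤ (j : ℕ) then barnesG (a j - s) τ else 1)

/-- `N = 2(m+n) - p - q`. -/
def paramN (m n p q : ℕ) : ℤ := 2 * (m + n) - p - q

/-- `ν = Σ a_j - Σ b_j`. -/
def paramNu {p q : ℕ} (a : Fin p → ℂ) (b : Fin q → ℂ) : ℂ := (∑ j, a j) - ∑ j, b j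

/-- `μ = Σ_{j≤n} a_j - Σ_{j>n} a_j + Σ_{j≤m} b_j - Σ_{j>m} b_j`. -/
def paramMu (m n : ℕ) {p q : ℕ} (a : Fin p → ℂ) (b : Fin q → ℂ) : ℂ :=
  (∑ j : Fin p, if (j : ℕ) < n then a j else 0) - (∑ j : Fin p, if n ≤ (j : ℕ) then a j else 0)
    + (∑ j : Fin q, if (j : ℕ) < m then b j else 0) - ∑ j : Fin q, if m ≤ (j : ℕ) then b j else 0

/-- `ξ = Σ_{j≤n} a_j² - Σ_{j>n} a_j² + Σ_{j≤m} b_j² - Σ_{j>m} b_j²`. -/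
def paramXi (m n : ℕ) {p q : ℕ} (a : Fin p → ℂ) (b : Fin q → ℂ) : ℂ :=
  (∑ j : Fin p, if (j : ℕ) < n then a j ^ 2 else 0)
    - (∑ j : Fin p, if n ≤ (j : ℕ) then a j ^ 2 else 0)
    + (∑ j : Fin q, if (j : ℕ) < m then b j ^ 2 else 0)
    - ∑ j : Fin q, if m ≤ (j : ℕ) then b j ^ 2 else 0

/-- The Meijer–Barnes `K`-function with vertical contour `c + iℝ`, at the variable `z > 0`:
`K^{m,n}_{p,q}(a;b | z; τ, α) = (1/(2πi)) ∫_{c+iℝ} 𝒢(s) e^{(πα/τ)s²} z^{-s} ds`. -/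
def KfunZ (m n : ℕ) {p q : ℕ} (a : Fin p → ℂ) (b : Fin q → ℂ) (τ α : ℂ) (c : ℝ) (z : ℝ) : ℂ :=
  1 / (2 * Real.pi * Complex.I) *
    ∫ t : ℝ, (calG m n a b (c + t * Complex.I) τ *
      Complex.exp ((Real.pi : ℂ) * α / τ * (c + t * Complex.I) ^ 2) *
      Complex.exp (-((c + t * Complex.I) * Real.log z))) * Complex.I

/-- The Weierstrass elementary factor of genus two, `(1 + u) exp (-u + u² / 2)`. -/
def elemFactor (u : ℂ) : ℂ := (1 + u) * Complex.exp (-u + u ^ 2 / 2)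

lemma elemFactor_zero : elemFactor 0 = 1 := by simp [elemFactor]

lemma differentiable_elemFactor : Differentiable ℂ elemFactor := by
  unfold elemFactor; fun_prop

lemma elemFactor_ne_zero {u : ℂ} (hu : 1 + u ≠ 0) : elemFactor u ≠ 0 :=
  mul_ne_zero hu (Complex.exp_ne_zero _)

lemma exists_elemFactor_eq_exp {u : ℂ} (hu : ‖u‖ ≤ 1 / 2) :
    ∃ v : ℂ, elemFactor u = Complex.exp v ∧ ‖v‖ ≤ ‖u‖ ^ 3 := by
  have h1 : ‖u‖ < 1 := by linarith
  have hne : 1 + u ≠ 0 := by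
    intro h
    have : u = -1 := by linear_combination h
    rw [this] at hu
    norm_num at hu
  refine ⟨Complex.log (1 + u) - u + u ^ 2 / 2, ?_, ?_⟩
  · rw [elemFactor, sub_add, Complex.exp_sub, Complex.exp_log hne,
      show -u + u ^ 2 / 2 = -(u - u ^ 2 / 2) by ring, Complex.exp_neg, ← div_eq_mul_inv]
  · have h := Complex.norm_log_sub_logTaylor_le 2 h1
    have h2 : Complex.logTaylor (2 + 1) u = u - u ^ 2 / 2 := by
      simp [Complex.logTaylor_succ, Complex.logTaylor_zero]
      ring
    rw [h2] at h
    have h3 : Complex.log (1 + u) - u + u ^ 2 / 2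
        = Complex.log (1 + u) - (u - u ^ 2 / 2) := by ring
    rw [h3]
    refine h.trans ?_
    have h4 : (1 - ‖u‖)⁻¹ ≤ 2 := by
      rw [inv_le_comm₀ (by linarith) two_pos]; linarith
    have h5 : ‖u‖ ^ 3 * (1 - ‖u‖)⁻¹ ≤ ‖u‖ ^ 3 * 2 := by gcongr
    have h6 : 0 ≤ ‖u‖ ^ 3 := by positivity
    norm_num
    rw [div_le_iff₀ (by norm_num)]
    linarith

lemma norm_elemFactor_le (u : ℂ) : ‖elemFactor u‖ ≤ Real.exp (9 * ‖u‖ ^ 3) := by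
  have h0 := norm_nonneg u
  rcases le_total ‖u‖ (1 / 2) with h | h
  · obtain ⟨v, hv, hv'⟩ := exists_elemFactor_eq_exp h
    rw [hv, Complex.norm_exp]
    have := Complex.re_le_norm v
    have h6 : 0 ≤ ‖u‖ ^ 3 := by positivity
    exact Real.exp_le_exp.2 (by linarith)
  · rw [elemFactor, norm_mul, Complex.norm_exp]
    have h1 : ‖1 + u‖ ≤ Real.exp ‖u‖ := by
      refine (norm_add_le _ _).trans ?_
      have := Real.add_one_le_exp ‖u‖
      simp only [norm_one]; linarith
    have h2 : (-u + u ^ 2 / 2).re ≤ ‖u‖ + ‖u‖ ^ 2 / 2 := by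
      refine (Complex.re_le_norm _).trans ((norm_add_le _ _).trans ?_)
      simp
    calc _ ≤ Real.exp ‖u‖ * Real.exp (‖u‖ + ‖u‖ ^ 2 / 2) := by
          gcongr
      _ ≤ _ := by
          rw [← Real.exp_add]
          apply Real.exp_le_exp.2
          have h3 : 1 ≤ 2 * ‖u‖ := by linarith
          have h4 : ‖u‖ ^ 2 ≤ 2 * ‖u‖ ^ 3 := by nlinarith [sq_nonneg ‖u‖]
          have h5 : ‖u‖ ≤ 2 * ‖u‖ ^ 2 := by nlinarith
          linarith

lemma norm_elemFactor_sub_one_le {u : ℂ} {R : ℝ} (hu : ‖u‖ ≤ R) :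
    ‖elemFactor u - 1‖ ≤ 8 * (Real.exp (9 * R ^ 3) + 1) * ‖u‖ ^ 3 := by
  have h0 := norm_nonneg u
  have h6 : 0 ≤ ‖u‖ ^ 3 := by positivity
  rcases le_total ‖u‖ (1 / 2) with h | h
  · obtain ⟨v, hv, hv'⟩ := exists_elemFactor_eq_exp h
    rw [hv]
    have h7 : ‖u‖ ^ 3 ≤ 1 := pow_le_one₀ h0 (by linarith)
    have := Complex.norm_exp_sub_one_le (x := v) (by linarith)
    have := Real.exp_pos (9 * R ^ 3)
    nlinarith
  · have h1 := norm_elemFactor_le u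
    have h2 : ‖elemFactor u - 1‖ ≤ ‖elemFactor u‖ + 1 := by
      simpa using norm_sub_le (elemFactor u) 1
    have h3 : Real.exp (9 * ‖u‖ ^ 3) ≤ Real.exp (9 * R ^ 3) := by gcongr
    have h4 : 1 ≤ 8 * ‖u‖ ^ 3 := by
      have : (1 / 2 : ℝ) ^ 3 ≤ ‖u‖ ^ 3 := by gcongr
      norm_num at this; linarith
    have := Real.exp_pos (9 * R ^ 3)
    nlinarith

/-- Comparison of two elementary factors with the same zero. -/
lemma elemFactor_div_eq {z w l : ℂ} (hl : l ≠ 0) (hw : l + w ≠ 0) :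
    elemFactor (z / l) = elemFactor (w / l) * elemFactor ((z - w) / (l + w)) *
      Complex.exp ((z - w) * w ^ 2 / (l ^ 2 * (l + w)) +
        (z - w) ^ 2 * w * (2 * l + w) / (2 * l ^ 2 * (l + w) ^ 2)) := by
  have h1 : (1 + z / l) = (1 + w / l) * (1 + (z - w) / (l + w)) := by
    field_simp; ring
  have h2 : -(z / l) + (z / l) ^ 2 / 2 = (-(w / l) + (w / l) ^ 2 / 2)
      + (-((z - w) / (l + w)) + ((z - w) / (l + w)) ^ 2 / 2)
      + ((z - w) * w ^ 2 / (l ^ 2 * (l + w)) +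
        (z - w) ^ 2 * w * (2 * l + w) / (2 * l ^ 2 * (l + w) ^ 2)) := by
    field_simp; ring
  simp only [elemFactor]
  rw [h2, h1, Complex.exp_add, Complex.exp_add]
  ring

lemma norm_elemFactor_div_le {z w : ℂ} {l R : ℝ} (hl : 0 < l) (hR : 0 ≤ R)
    (hre : |w.re| ≤ R) (him : 1 ≤ |w.im|) (hzw : ‖z - w‖ ≤ R) :
    ‖elemFactor (z / l)‖ ≤ Real.exp (15 * (R + 2) ^ 6 * (‖w‖ * √‖w‖) * (l ^ 2 * √l)⁻¹) *
      ‖elemFactor (w / l)‖ := by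
  set d := ‖(l : ℂ) + w‖ with hd
  set K := R + 2 with hK
  have hyd : |w.im| ≤ d := by simpa using Complex.abs_im_le_norm ((l : ℂ) + w)
  have hd1 : 1 ≤ d := him.trans hyd
  have hwim : |w.im| ≤ ‖w‖ := Complex.abs_im_le_norm w
  have hw1 : 1 ≤ ‖w‖ := him.trans hwim
  have hwd : ‖w‖ ≤ (R + 1) * d := by
    have := Complex.norm_le_abs_re_add_abs_im w
    nlinarith
  have hwK : ‖w‖ ≤ K * d := by nlinarith
  have hlK : l ≤ K * d := by
    have : ‖(l : ℂ)‖ ≤ ‖(l : ℂ) + w‖ + ‖w‖ := by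
      simpa using norm_sub_le ((l : ℂ) + w) w
    rw [Complex.norm_real, Real.norm_of_nonneg hl.le] at this
    nlinarith
  set r := √‖w‖ with hr
  set p := √l with hp
  have hr2 : ‖w‖ = r ^ 2 := by rw [hr, Real.sq_sqrt (norm_nonneg _)]
  have hp2 : l = p ^ 2 := by rw [hp, Real.sq_sqrt hl.le]
  have hr1 : 1 ≤ r := by rw [hr]; exact Real.one_le_sqrt.2 hw1
  have hp0 : 0 < p := Real.sqrt_pos.2 hl
  have hK1 : 2 ≤ K := by linarith
  have hd0 : 0 < d := by linarith
  have hprd : p * r ≤ K * d := by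
    have : (p * r) ^ 2 ≤ (K * d) ^ 2 := by
      rw [mul_pow, ← hr2, ← hp2, sq (K * d)]
      exact mul_le_mul hlK hwK (norm_nonneg _) (by positivity)
    exact le_of_sq_le_sq this (by positivity)
  have hp5 : p ^ 5 ≤ K ^ 3 * d ^ 3 := by
    have h1 : p ^ 2 ≤ K * d := hp2 ▸ hlK
    have h2 : p ≤ K * d := by
      have : 1 ≤ K * d := by nlinarith
      by_contra hcon
      push Not at hcon
      nlinarith
    calc p ^ 5 = p ^ 2 * p ^ 2 * p := by ring
      _ ≤ (K * d) * (K * d) * (K * d) := by gcongr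
      _ = _ := by ring
  have hlne : (l : ℂ) ≠ 0 := by exact_mod_cast hl.ne'
  have hlw : (l : ℂ) + w ≠ 0 := by rw [← norm_pos_iff]; exact hd0
  have hWE : ‖w‖ * r * (l ^ 2 * p)⁻¹ = r ^ 3 / p ^ 5 := by
    rw [hr2, hp2]; field_simp
  have e1 : 9 * ‖(z - w) / (l + w)‖ ^ 3 ≤ 9 * K ^ 6 * (r ^ 3 / p ^ 5) := by
    rw [norm_div, div_pow, ← hd, mul_assoc]
    gcongr 9 * ?_
    rw [← mul_div_assoc, div_le_div_iff₀ (by positivity) (by positivity)]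
    calc ‖z - w‖ ^ 3 * p ^ 5 ≤ K ^ 3 * (K ^ 3 * d ^ 3) := by
          gcongr; linarith
      _ ≤ K ^ 6 * r ^ 3 * d ^ 3 := by
          have : 1 ≤ r ^ 3 := one_le_pow₀ hr1
          have h : 0 ≤ K ^ 6 * d ^ 3 := by positivity
          nlinarith
  have e2 : ‖(z - w) * w ^ 2 / (l ^ 2 * (l + w))‖ ≤ 2 * K ^ 6 * (r ^ 3 / p ^ 5) := by
    rw [norm_div, norm_mul, norm_mul, norm_pow, norm_pow, ← hd, Complex.norm_real,
      Real.norm_of_nonneg hl.le, hr2, hp2, ← mul_div_assoc,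
      div_le_div_iff₀ (by positivity) (by positivity)]
    calc ‖z - w‖ * (r ^ 2) ^ 2 * p ^ 5 = ‖z - w‖ * (p * r) * (r ^ 3 * p ^ 4) := by ring
      _ ≤ K * (K * d) * (r ^ 3 * p ^ 4) := by gcongr; linarith
      _ = K ^ 2 * (r ^ 3 * p ^ 4 * d) := by ring
      _ ≤ (2 * K ^ 6) * (r ^ 3 * p ^ 4 * d) := by
          gcongr
          nlinarith [pow_le_pow_right₀ (by linarith : 1 ≤ K) (by norm_num : 2 ≤ 6),
            pow_pos (by linarith : 0 < K) 6]
      _ = _ := by ring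
  have e3 : ‖(z - w) ^ 2 * w * (2 * l + w) / (2 * l ^ 2 * (l + w) ^ 2)‖
      ≤ 4 * K ^ 6 * (r ^ 3 / p ^ 5) := by
    have h2l : ‖(2 * (l : ℂ) + w)‖ ≤ 3 * K * d := by
      refine (norm_add_le _ _).trans ?_
      rw [norm_mul, Complex.norm_real, Real.norm_of_nonneg hl.le]
      norm_num
      linarith
    rw [norm_div, norm_mul, norm_mul, norm_mul, norm_mul, norm_pow, norm_pow, norm_pow, ← hd,
      Complex.norm_real, Real.norm_of_nonneg hl.le, ← mul_div_assoc]
    rw [div_le_div_iff₀ (by simp; positivity) (by positivity)]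
    rw [hr2, hp2, Complex.norm_ofNat]
    calc ‖z - w‖ ^ 2 * r ^ 2 * ‖2 * ((p ^ 2 : ℝ) : ℂ) + w‖ * p ^ 5
        ≤ K ^ 2 * r ^ 2 * (3 * K * d) * p ^ 5 := by
          rw [← hp2]; gcongr; linarith
      _ = 3 * K ^ 3 * d * (p * 1) * (r ^ 2 * p ^ 4) := by ring
      _ ≤ 3 * K ^ 3 * d * (p * r) * (r ^ 2 * p ^ 4) := by gcongr
      _ ≤ 3 * K ^ 3 * d * (K * d) * (r ^ 2 * p ^ 4) := by gcongr
      _ = 3 * K ^ 4 * (r ^ 2 * p ^ 4 * d ^ 2) * 1 := by ring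
      _ ≤ 8 * K ^ 6 * (r ^ 2 * p ^ 4 * d ^ 2) * r := by
          have := pow_le_pow_right₀ (by linarith : 1 ≤ K) (by norm_num : 4 ≤ 6)
          gcongr
          norm_num
      _ = _ := by ring
  rw [elemFactor_div_eq hlne hlw, norm_mul, norm_mul, Complex.norm_exp, mul_comm _ ‖elemFactor (w / l)‖,
    mul_assoc]
  gcongr
  refine (mul_le_mul_of_nonneg_right (norm_elemFactor_le _) (Real.exp_pos _).le).trans ?_
  rw [← Real.exp_add, mul_assoc _ (‖w‖ * r), hWE]
  apply Real.exp_le_exp.2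
  have e4 := (Complex.re_le_norm ((z - w) * w ^ 2 / (l ^ 2 * (l + w)) +
    (z - w) ^ 2 * w * (2 * l + w) / (2 * l ^ 2 * (l + w) ^ 2))).trans (norm_add_le _ _)
  linarith

lemma norm_elemFactor_mul_I (y : ℝ) :
    ‖elemFactor (y * I)‖ ≤ 1 ∧ (1 ≤ |y| → ‖elemFactor (y * I)‖ ≤ Real.exp (-(y ^ 2 / 8))) := by
  have h : ‖elemFactor (y * I)‖ ^ 2 = (1 + y ^ 2) * Real.exp (-y ^ 2) := by
    rw [elemFactor, norm_mul, mul_pow, Complex.norm_exp, ← Real.exp_nat_mul, Complex.sq_norm,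
      Complex.normSq_apply]
    have : (-(y * I : ℂ) + (y * I) ^ 2 / 2).re = -y ^ 2 / 2 := by
      rw [mul_pow, I_sq]
      have : -(y * I : ℂ) + y ^ 2 * -1 / 2 = ((-y ^ 2 / 2 : ℝ) : ℂ) + ((-y : ℝ) : ℂ) * I := by
        push_cast; ring
      rw [this, Complex.add_re, Complex.ofReal_re, Complex.re_ofReal_mul, Complex.I_re]
      ring
    rw [this]
    simp only [add_re, one_re, mul_re, ofReal_re, I_re, mul_zero, ofReal_im, I_im, mul_one,
      sub_self, add_zero, add_im, one_im, mul_im, zero_add]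
    push_cast
    rw [show 2 * (-y ^ 2 / 2) = -y ^ 2 by ring]
    ring
  constructor
  · have h1 : ‖elemFactor (y * I)‖ ^ 2 ≤ 1 := by
      rw [h, Real.exp_neg, ← div_eq_mul_inv, div_le_one (Real.exp_pos _)]
      have := Real.add_one_le_exp (y ^ 2)
      linarith
    exact (sq_le_one_iff₀ (norm_nonneg _)).1 h1
  · intro hy
    have hy2 : 1 ≤ y ^ 2 := by rw [← sq_abs]; nlinarith
    have h1 : 1 + y ^ 2 ≤ Real.exp (3 / 4 * y ^ 2) := by
      have := Real.quadratic_le_exp_of_nonneg (x := 3 / 4 * y ^ 2) (by positivity)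
      nlinarith
    have h2 : ‖elemFactor (y * I)‖ ^ 2 ≤ Real.exp (-(y ^ 2 / 8)) ^ 2 := by
      rw [h, ← Real.exp_nat_mul]
      calc _ ≤ Real.exp (3 / 4 * y ^ 2) * Real.exp (-y ^ 2) := by gcongr
        _ = _ := by rw [← Real.exp_add]; congr 1; push_cast; ring
    exact le_of_sq_le_sq h2 (Real.exp_pos _).le

/-- The lattice points `m τ + n` in the product for the double gamma function. -/
def latticePt (τ : ℝ) (x : ℕ × ℕ) : ℝ := x.1 * τ + x.2

lemma latticePt_zero (τ : ℝ) : latticePt τ (0, 0) = 0 := by simp [latticePt]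

lemma min_mul_le_latticePt (τ : ℝ) (x : ℕ × ℕ) :
    min τ 1 * (x.1 + x.2) ≤ latticePt τ x := by
  have h1 : min τ 1 ≤ τ := min_le_left _ _
  have h2 : min τ 1 ≤ 1 := min_le_right _ _
  have h3 : (0 : ℝ) ≤ x.1 := by positivity
  have h4 : (0 : ℝ) ≤ x.2 := by positivity
  unfold latticePt
  nlinarith

lemma min_le_latticePt {τ : ℝ} (hτ : 0 < τ) {x : ℕ × ℕ} (hx : x ≠ (0, 0)) :
    min τ 1 ≤ latticePt τ x := by
  refine le_trans ?_ (min_mul_le_latticePt τ x)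
  have h0 : 0 < min τ 1 := lt_min hτ one_pos
  have h1 : 1 ≤ x.1 + x.2 := by
    by_contra h
    apply hx
    ext <;> simp <;> omega
  have h2 : (1 : ℝ) ≤ x.1 + x.2 := by exact_mod_cast h1
  nlinarith

lemma latticePt_nonneg {τ : ℝ} (hτ : 0 < τ) (x : ℕ × ℕ) : 0 ≤ latticePt τ x := by
  unfold latticePt; positivity

lemma latticePt_pos {τ : ℝ} (hτ : 0 < τ) {x : ℕ × ℕ} (hx : x ≠ (0, 0)) :
    0 < latticePt τ x :=
  (lt_min hτ one_pos).trans_le (min_le_latticePt hτ hx)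

lemma summable_latticePt_inv {τ : ℝ} (hτ : 0 < τ) :
    Summable fun x : ℕ × ℕ => (latticePt τ x ^ 2 * √(latticePt τ x))⁻¹ := by
  have h0 : 0 < min τ 1 := lt_min hτ one_pos
  have h := EisensteinSeries.summable_one_div_norm_rpow (k := 5 / 2) (by norm_num)
  let φ : ℕ × ℕ → (Fin 2 → ℤ) := fun x => ![(x.1 : ℤ), (x.2 : ℤ)]
  have hφ : Function.Injective φ := by
    rintro ⟨x1, x2⟩ ⟨y1, y2⟩ hxy
    have h1 := congrFun hxy 0
    have h2 := congrFun hxy 1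
    simp [φ] at h1 h2
    simp [h1, h2]
  have h2 := (h.comp_injective hφ).mul_left ((min τ 1 ^ 2 * √(min τ 1))⁻¹)
  refine Summable.of_nonneg_of_le (fun x => ?_) (fun x => ?_) h2
  · positivity
  · by_cases hx : x = (0, 0)
    · simp [hx, latticePt_zero]; positivity
    · have hn : ‖φ x‖ ≤ (x.1 + x.2 : ℝ) := by
        rw [pi_norm_le_iff_of_nonneg (by positivity)]
        intro i
        fin_cases i <;> simp [φ]
      have hpos : 0 < ‖φ x‖ := by
        rw [norm_pos_iff]
        intro hz
        apply hx
        have h1 := congrFun hz 0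
        have h2 := congrFun hz 1
        simp [φ] at h1 h2
        ext <;> simp [h1, h2]
      have hl : min τ 1 * ‖φ x‖ ≤ latticePt τ x :=
        (mul_le_mul_of_nonneg_left hn h0.le).trans (min_mul_le_latticePt τ x)
      have e : ‖φ x‖ ^ (-(5 / 2) : ℝ) = (‖φ x‖ ^ 2 * √‖φ x‖)⁻¹ := by
        rw [Real.rpow_neg hpos.le, Real.sqrt_eq_rpow, ← Real.rpow_natCast, ← Real.rpow_add hpos]
        norm_num
      simp only [Function.comp]
      rw [e, ← mul_inv]
      apply inv_anti₀ (by positivity)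
      calc _ = (min τ 1 * ‖φ x‖) ^ 2 * √(min τ 1 * ‖φ x‖) := by
            rw [Real.sqrt_mul h0.le]; ring
        _ ≤ _ := by gcongr

lemma summable_latticePt_inv_cube {τ : ℝ} (hτ : 0 < τ) :
    Summable fun x : ℕ × ℕ => (latticePt τ x ^ 3)⁻¹ := by
  have h0 : 0 < min τ 1 := lt_min hτ one_pos
  refine Summable.of_nonneg_of_le (fun x => ?_) (fun x => ?_)
    ((summable_latticePt_inv hτ).mul_left (√(min τ 1))⁻¹)
  · have := latticePt_nonneg hτ x
    positivity
  · by_cases hx : x = (0, 0)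
    · simp [hx, latticePt_zero]
    · have h1 := latticePt_pos hτ hx
      rw [← mul_inv]
      apply inv_anti₀ (by positivity)
      calc √(min τ 1) * (latticePt τ x ^ 2 * √(latticePt τ x))
          ≤ √(latticePt τ x) * (latticePt τ x ^ 2 * √(latticePt τ x)) := by
            gcongr; exact min_le_latticePt hτ hx
        _ = latticePt τ x ^ 2 * (√(latticePt τ x)) ^ 2 := by ring
        _ = _ := by rw [Real.sq_sqrt h1.le]; ring

lemma not_summable_latticePt_inv_sq {τ : ℝ} (hτ : 0 < τ) :
    ¬ Summable fun x : ℕ × ℕ => (latticePt τ x ^ 2)⁻¹ := by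
  intro h
  have h1 := h.prod
  apply Real.not_summable_natCast_inv
  have h2 := h1.mul_left ((τ + 1) ^ 2)
  refine Summable.of_nonneg_of_le (fun k => by positivity) (fun k => ?_) h2
  have h3 : ∑ j ∈ Finset.range k, (latticePt τ (k, j) ^ 2)⁻¹ ≤
      ∑' j, (latticePt τ (k, j) ^ 2)⁻¹ :=
    (h.prod_factor k).sum_le_tsum _ (fun j _ => by positivity)
  rcases Nat.eq_zero_or_pos k with rfl | hk
  · simp only [Nat.cast_zero, inv_zero]
    exact mul_nonneg (by positivity) (tsum_nonneg fun _ => by positivity)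
  have hk' : (0 : ℝ) < k := by exact_mod_cast hk
  have h4 : (k : ℝ) * ((k * (τ + 1)) ^ 2)⁻¹ ≤
      ∑ j ∈ Finset.range k, (latticePt τ (k, j) ^ 2)⁻¹ := by
    have := Finset.card_nsmul_le_sum (Finset.range k)
      (fun j => (latticePt τ (k, j) ^ 2)⁻¹) (((k * (τ + 1)) ^ 2)⁻¹) (fun j hj => by
        have hj' : (j : ℝ) ≤ k := by exact_mod_cast (Finset.mem_range.1 hj).le
        have hne : 0 < latticePt τ (k, j) := latticePt_pos hτ (by simp; omega)
        apply inv_anti₀ (by positivity)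
        gcongr
        unfold latticePt
        simp only
        linarith)
    simpa using this
  calc (k : ℝ)⁻¹ = (τ + 1) ^ 2 * (k * ((k * (τ + 1)) ^ 2)⁻¹) := by
        field_simp
    _ ≤ _ := by gcongr; exact h4.trans h3

/-- The canonical product over the nonzero points of the lattice cone. -/
def latticeProd (τ : ℝ) (z : ℂ) : ℂ := ∏' x : ℕ × ℕ, elemFactor (z / latticePt τ x)

lemma norm_elemFactor_lattice_le {τ : ℝ} (hτ : 0 < τ) {z : ℂ} {R : ℝ} (hz : ‖z‖ ≤ R)
    (x : ℕ × ℕ) : ‖elemFactor (z / latticePt τ x) - 1‖ ≤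
      8 * (Real.exp (9 * (R / min τ 1) ^ 3) + 1) * R ^ 3 * (latticePt τ x ^ 3)⁻¹ := by
  have h0 : 0 < min τ 1 := lt_min hτ one_pos
  by_cases hx : x = (0, 0)
  · simp [hx, latticePt_zero, elemFactor_zero]
  · have h1 := latticePt_pos hτ hx
    have hR : 0 ≤ R := (norm_nonneg z).trans hz
    have e : ‖z / latticePt τ x‖ = ‖z‖ / latticePt τ x := by
      rw [norm_div, Complex.norm_real, Real.norm_of_nonneg h1.le]
    have h2 : ‖z / latticePt τ x‖ ≤ R / min τ 1 := by
      rw [e]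
      gcongr
      exact min_le_latticePt hτ hx
    refine (norm_elemFactor_sub_one_le h2).trans ?_
    rw [mul_assoc _ (R ^ 3), e, ← div_eq_mul_inv, ← div_pow]
    gcongr

lemma summable_norm_elemFactor_sub_one {τ : ℝ} (hτ : 0 < τ) (z : ℂ) :
    Summable fun x : ℕ × ℕ => ‖elemFactor (z / latticePt τ x) - 1‖ :=
  Summable.of_nonneg_of_le (fun _ => norm_nonneg _)
    (fun x => norm_elemFactor_lattice_le hτ le_rfl x)
    ((summable_latticePt_inv_cube hτ).mul_left _)

lemma hasProd_latticeProd {τ : ℝ} (hτ : 0 < τ) (z : ℂ) :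
    HasProd (fun x : ℕ × ℕ => elemFactor (z / latticePt τ x)) (latticeProd τ z) := by
  have := multipliable_one_add_of_summable (summable_norm_elemFactor_sub_one hτ z)
  simp only [add_sub_cancel] at this
  exact this.hasProd

lemma latticeProd_ne_zero {τ : ℝ} (hτ : 0 < τ) {z : ℂ}
    (hz : ∀ x : ℕ × ℕ, x ≠ (0, 0) → z + latticePt τ x ≠ 0) : latticeProd τ z ≠ 0 := by
  have := tprod_one_add_ne_zero_of_summable (fun x => ?_) (summable_norm_elemFactor_sub_one hτ z)
  · simp only [add_sub_cancel] at this
    exact this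
  · rw [add_sub_cancel]
    by_cases hx : x = (0, 0)
    · simp [hx, latticePt_zero, elemFactor_zero]
    · apply elemFactor_ne_zero
      have h1 : (latticePt τ x : ℂ) ≠ 0 := by exact_mod_cast (latticePt_pos hτ hx).ne'
      have := hz x hx
      intro h
      apply this
      field_simp at h
      rw [add_comm]; simpa using h

lemma differentiable_latticeProd {τ : ℝ} (hτ : 0 < τ) : Differentiable ℂ (latticeProd τ) := by
  intro z
  have hU : IsOpen (Metric.ball (0 : ℂ) (‖z‖ + 1)) := Metric.isOpen_ball
  have hd : ∀ x : ℕ × ℕ, Differentiable ℂ fun z => elemFactor (z / latticePt τ x) := fun x =>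
    differentiable_elemFactor.comp (by fun_prop)
  have h := Summable.hasProdLocallyUniformlyOn_one_add (K := Metric.ball (0 : ℂ) (‖z‖ + 1))
    (f := fun x z => elemFactor (z / latticePt τ x) - 1) hU
    ((summable_latticePt_inv_cube hτ).mul_left
      (8 * (Real.exp (9 * ((‖z‖ + 1) / min τ 1) ^ 3) + 1) * (‖z‖ + 1) ^ 3))
    (Eventually.of_forall fun x w hw => norm_elemFactor_lattice_le hτ
      (by simpa using (mem_ball_zero_iff.1 hw).le) x)
    (fun x => ((hd x).continuous.sub continuous_const).continuousOn)
  simp only [add_sub_cancel] at h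
  rw [hasProdLocallyUniformlyOn_iff_tendstoLocallyUniformlyOn] at h
  have h2 := h.differentiableOn (Eventually.of_forall fun s =>
    (DifferentiableOn.fun_finsetProd fun x _ => (hd x).differentiableOn)) hU
  exact h2.differentiableAt (hU.mem_nhds (by simp))

lemma norm_latticeProd_le {τ : ℝ} (hτ : 0 < τ) {R : ℝ} (hR : 0 ≤ R) :
    ∃ C : ℝ, 0 ≤ C ∧ ∀ z w : ℂ, |w.re| ≤ R → 1 ≤ |w.im| → ‖z - w‖ ≤ R →
      ‖latticeProd τ z‖ ≤ Real.exp (C * (‖w‖ * √‖w‖)) * ‖latticeProd τ w‖ := by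
  set S := ∑' x : ℕ × ℕ, (latticePt τ x ^ 2 * √(latticePt τ x))⁻¹ with hS
  have hS0 : 0 ≤ S := tsum_nonneg fun x => by positivity
  refine ⟨15 * (R + 2) ^ 6 * S, by positivity, fun z w h1 h2 h3 => ?_⟩
  have hz := (hasProd_latticeProd hτ z).norm
  have hw := (hasProd_latticeProd hτ w).norm.const_mul
    (Real.exp (15 * (R + 2) ^ 6 * S * (‖w‖ * √‖w‖)))
  refine le_of_tendsto_of_tendsto' hz hw fun s => ?_
  have hb : ∀ x ∈ s, ‖elemFactor (z / latticePt τ x)‖ ≤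
      Real.exp (15 * (R + 2) ^ 6 * (‖w‖ * √‖w‖) *
        (latticePt τ x ^ 2 * √(latticePt τ x))⁻¹) * ‖elemFactor (w / latticePt τ x)‖ := by
    intro x _
    by_cases hx : x = (0, 0)
    · simp [hx, latticePt_zero, elemFactor_zero]
    · exact norm_elemFactor_div_le (latticePt_pos hτ hx) hR h1 h2 h3
  refine (Finset.prod_le_prod (fun _ _ => norm_nonneg _) hb).trans ?_
  rw [Finset.prod_mul_distrib, ← Real.exp_sum, ← Finset.mul_sum]
  have hp : 0 ≤ ∏ x ∈ s, ‖elemFactor (w / latticePt τ x)‖ :=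
    Finset.prod_nonneg fun _ _ => norm_nonneg _
  have hs := (summable_latticePt_inv hτ).sum_le_tsum s (fun x _ => by positivity)
  refine mul_le_mul_of_nonneg_right (Real.exp_le_exp.2 ?_) hp
  calc _ ≤ 15 * (R + 2) ^ 6 * (‖w‖ * √‖w‖) * S := by gcongr
    _ = _ := by ring

lemma norm_latticeProd_neg_mul_I {τ : ℝ} (hτ : 0 < τ) (t : ℝ) :
    ‖latticeProd τ (-(t * I))‖ = ‖latticeProd τ (t * I)‖ := by
  refine tendsto_nhds_unique (hasProd_latticeProd hτ (-(t * I))).norm ?_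
  refine (hasProd_latticeProd hτ (t * I)).norm.congr fun s => ?_
  refine Finset.prod_congr rfl fun x _ => ?_
  have : -(t * I) / (latticePt τ x : ℂ) = (starRingEnd ℂ) (t * I / (latticePt τ x : ℂ)) := by
    simp
  beta_reduce
  rw [this, ← Complex.norm_conj]
  congr 1
  simp [elemFactor, ← Complex.exp_conj, map_ofNat]

lemma norm_latticeProd_mul_I_le {τ : ℝ} (hτ : 0 < τ) (K : ℝ) :
    ∃ T : ℝ, ∀ t : ℝ, T ≤ |t| → ‖latticeProd τ (t * I)‖ ≤ Real.exp (-(K * t ^ 2)) := by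
  obtain ⟨s, hs⟩ : ∃ s : Finset (ℕ × ℕ), 8 * K ≤ ∑ x ∈ s, (latticePt τ x ^ 2)⁻¹ := by
    by_contra! hcon
    exact not_summable_latticePt_inv_sq hτ
      (summable_of_sum_le (fun x => by positivity) fun u => (hcon u).le)
  refine ⟨∑ x ∈ s, latticePt τ x, fun t ht => ?_⟩
  refine le_of_tendsto (hasProd_latticeProd hτ (t * I)).norm ?_
  filter_upwards [eventually_ge_atTop s] with u hu
  have hf : ∀ x : ℕ × ℕ, (t * I / (latticePt τ x : ℂ)) = ((t / latticePt τ x : ℝ) : ℂ) * I := by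
    intro x; push_cast; ring
  calc ∏ x ∈ u, ‖elemFactor (t * I / latticePt τ x)‖
      ≤ ∏ x ∈ s, ‖elemFactor (t * I / latticePt τ x)‖ := by
        refine Finset.prod_le_prod_of_subset_of_le_one hu (fun _ _ => norm_nonneg _) ?_
        intro x _ _
        rw [hf]
        exact (norm_elemFactor_mul_I _).1
    _ ≤ ∏ x ∈ s, Real.exp (-(t ^ 2 / 8 * (latticePt τ x ^ 2)⁻¹)) := by
        refine Finset.prod_le_prod (fun _ _ => norm_nonneg _) fun x hx => ?_
        by_cases hx0 : x = (0, 0)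
        · simp [hx0, latticePt_zero, elemFactor_zero]
        · rw [hf]
          have hl := latticePt_pos hτ hx0
          refine ((norm_elemFactor_mul_I _).2 ?_).trans_eq ?_
          · rw [abs_div, abs_of_pos hl, one_le_div hl]
            exact (Finset.single_le_sum (fun y _ => latticePt_nonneg hτ y) hx).trans ht
          · rw [div_pow]; congr 1; ring
    _ = Real.exp (-(t ^ 2 / 8 * ∑ x ∈ s, (latticePt τ x ^ 2)⁻¹)) := by
        rw [← Real.exp_sum, Finset.sum_neg_distrib, Finset.mul_sum]
    _ ≤ _ := by
        apply Real.exp_le_exp.2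
        have := sq_nonneg t
        nlinarith

lemma integrable_of_gaussian_bound {f : ℝ → ℂ} (hf : Continuous f) {κ D T : ℝ} (hκ : 0 < κ)
    (hb : ∀ t, T ≤ |t| → ‖f t‖ ≤ D * Real.exp (-(κ * t ^ 2))) : Integrable f := by
  obtain ⟨M, hM⟩ := (isCompact_Icc (a := -T) (b := T)).exists_bound_of_continuousOn
    (f := fun t => Real.exp (κ * t ^ 2) * ‖f t‖)
    (by fun_prop : Continuous fun t => Real.exp (κ * t ^ 2) * ‖f t‖).continuousOn
  have hgauss : Integrable fun t : ℝ => max D M * Real.exp (-κ * t ^ 2) :=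
    (integrable_exp_neg_mul_sq hκ).const_mul _
  refine hgauss.mono' hf.aestronglyMeasurable (Eventually.of_forall fun t => ?_)
  rw [neg_mul]
  rcases le_total T |t| with h | h
  · refine (hb t h).trans ?_
    gcongr
    exact le_max_left _ _
  · have := hM t (abs_le.1 h)
    rw [Real.norm_of_nonneg (by positivity)] at this
    have h2 : ‖f t‖ ≤ M * Real.exp (-(κ * t ^ 2)) := by
      rw [Real.exp_neg, ← div_eq_mul_inv, le_div_iff₀ (Real.exp_pos _)]
      linarith
    refine h2.trans ?_
    gcongr
    exact le_max_right _ _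

lemma continuous_vertical_line {f : ℂ → ℂ} {c : ℝ}
    (hf : ∀ s : ℂ, s.re = c → ContinuousAt f s) : Continuous fun t : ℝ => f (c + t * I) := by
  rw [continuous_iff_continuousAt]
  intro t
  have h1 : ContinuousAt (fun t : ℝ => (c + t * I : ℂ)) t := by fun_prop
  exact ContinuousAt.comp (g := f) (hf _ (by simp)) h1

/-- Cauchy's theorem for a vertical strip. -/
lemma integral_vertical_line_eq {Φ : ℂ → ℂ} {c' c : ℝ} (hcc : c' ≤ c)
    (hΦ : ∀ s : ℂ, c' ≤ s.re → s.re ≤ c → DifferentiableAt ℂ Φ s) {κ D T : ℝ} (hκ : 0 < κ)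
    (hb : ∀ s : ℂ, c' ≤ s.re → s.re ≤ c → T ≤ |s.im| →
      ‖Φ s‖ ≤ D * Real.exp (-(κ * s.im ^ 2))) :
    ∫ t : ℝ, Φ (c + t * I) = ∫ t : ℝ, Φ (c' + t * I) := by
  have hi : ∀ x : ℝ, c' ≤ x → x ≤ c → Integrable fun t : ℝ => Φ (x + t * I) := fun x h1 h2 =>
    integrable_of_gaussian_bound
      (continuous_vertical_line fun s hs =>
        (hΦ s (by rwa [hs]) (by rwa [hs])).continuousAt) hκ
      (fun t ht => by simpa using hb (x + t * I) (by simpa) (by simpa) (by simpa using ht))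
  have hl := intervalIntegral_tendsto_integral (hi c hcc le_rfl) tendsto_neg_atTop_atBot tendsto_id
  have hl' := intervalIntegral_tendsto_integral (hi c' le_rfl hcc) tendsto_neg_atTop_atBot
    tendsto_id
  have h0 : Tendsto (fun R : ℝ => (∫ t in (-R)..id R, Φ (c + t * I)) -
      ∫ t in (-R)..id R, Φ (c' + t * I)) atTop (nhds 0) := by
    have hexp : Tendsto (fun R : ℝ => 2 * (D * |c - c'|) * Real.exp (-(κ * R ^ 2))) atTop
        (nhds 0) := by
      have : Tendsto (fun R : ℝ => κ * R ^ 2) atTop atTop :=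
        (tendsto_pow_atTop two_ne_zero).const_mul_atTop hκ
      simpa using (Real.tendsto_exp_neg_atTop_nhds_zero.comp this).const_mul
        (2 * (D * |c - c'|))
    refine squeeze_zero_norm' ?_ hexp
    filter_upwards [eventually_ge_atTop (max T 0)] with R hR
    have hR0 : 0 ≤ R := (le_max_right _ _).trans hR
    have hRT : T ≤ R := (le_max_left _ _).trans hR
    have hrect := Complex.integral_boundary_rect_eq_zero_of_differentiableOn Φ
      (c' + ((-R : ℝ) : ℂ) * I) (c + (R : ℂ) * I) (by
        intro s hs
        rw [mem_reProdIm] at hs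
        simp only [add_re, ofReal_re, mul_re, I_re, mul_zero, ofReal_im, I_im, mul_one, sub_self,
          add_zero] at hs
        rw [uIcc_of_le hcc] at hs
        exact (hΦ s hs.1.1 hs.1.2).differentiableWithinAt)
    simp only [add_re, ofReal_re, mul_re, I_re, mul_zero, ofReal_im, I_im, mul_one, sub_self,
      add_zero, add_im, mul_im, zero_add, smul_eq_mul] at hrect
    have hh : ∀ y : ℝ, |y| = R → ‖∫ x : ℝ in c'..c, Φ (x + y * I)‖ ≤
        D * Real.exp (-(κ * R ^ 2)) * |c - c'| := by
      intro y hy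
      refine intervalIntegral.norm_integral_le_of_norm_le_const fun x hx => ?_
      rw [uIoc_of_le hcc] at hx
      have := hb (x + y * I) (by simpa using hx.1.le) (by simpa using hx.2)
        (by simpa [hy] using hRT)
      simpa [← hy] using this
    have e : (∫ t in (-R)..id R, Φ (c + t * I)) - ∫ t in (-R)..id R, Φ (c' + t * I) =
        I * ((∫ x : ℝ in c'..c, Φ (x + ((-R : ℝ) : ℂ) * I)) -
          ∫ x : ℝ in c'..c, Φ (x + (R : ℂ) * I)) := by
      simp only [id]
      linear_combination (-I) * hrect + ((∫ t in (-R)..R, Φ (c + t * I)) -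
        (∫ t in (-R)..R, Φ (c' + t * I))) * (Complex.I_mul_I)
    rw [e, norm_mul, norm_I, one_mul]
    refine (norm_sub_le _ _).trans ?_
    have h1 := hh (-R) (by rw [abs_neg, abs_of_nonneg hR0])
    have h2 := hh R (abs_of_nonneg hR0)
    linarith
  exact sub_eq_zero.1 (tendsto_nhds_unique (hl.sub hl') h0)

/-- The Taylor coefficients of the exponential at `0`, through iterated difference quotients. -/
def expQuot (m : ℕ) : ℂ → ℂ := (fun g => dslope g 0)^[m] Complex.exp

lemma differentiable_expQuot (m : ℕ) : Differentiable ℂ (expQuot m) := by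
  induction m with
  | zero => exact Complex.differentiable_exp
  | succ k ih =>
    rw [expQuot, Function.iterate_succ_apply']
    rw [← differentiableOn_univ] at ih ⊢
    exact (Complex.differentiableOn_dslope univ_mem).2 ih

lemma exp_eq_sum_add_expQuot (m : ℕ) (u : ℂ) :
    Complex.exp u = ∑ i ∈ Finset.range m, expQuot i 0 * u ^ i + u ^ m * expQuot m u := by
  induction m with
  | zero => simp [expQuot]
  | succ k ih =>
    rw [ih, Finset.sum_range_succ, add_assoc]
    congr 1
    have h : expQuot (k + 1) = dslope (expQuot k) 0 := by
      simp only [expQuot, Function.iterate_succ_apply']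
    have h2 := sub_smul_dslope (expQuot k) 0 u
    rw [h]
    simp only [sub_zero, smul_eq_mul] at h2
    rw [pow_succ, mul_assoc, h2]
    ring

lemma exists_hermite_idempotent {r : ℕ} (P : Fin r → ℂ) (hP : Function.Injective P)
    (d : Fin r → ℕ) (k : Fin r) : ∃ e : Polynomial ℂ,
      (Polynomial.X - Polynomial.C (P k)) ^ d k ∣ 1 - e ∧
      ∀ l, l ≠ k → (Polynomial.X - Polynomial.C (P l)) ^ d l ∣ e := by
  have hc : IsCoprime ((Polynomial.X - Polynomial.C (P k)) ^ d k)
      (∏ l ∈ Finset.univ.erase k, (Polynomial.X - Polynomial.C (P l)) ^ d l) := by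
    refine IsCoprime.prod_right fun l hl => IsCoprime.pow ?_
    exact Polynomial.pairwise_coprime_X_sub_C hP (Finset.ne_of_mem_erase hl).symm
  obtain ⟨u, v, huv⟩ := hc
  refine ⟨v * ∏ l ∈ Finset.univ.erase k, (Polynomial.X - Polynomial.C (P l)) ^ d l, ?_, ?_⟩
  · rw [← huv, add_sub_cancel_right]
    exact dvd_mul_left _ _
  · intro l hl
    exact (Finset.dvd_prod_of_mem _ (Finset.mem_erase.2 ⟨hl, Finset.mem_univ l⟩)).mul_left _

lemma Polynomial.exists_norm_eval_le (p : Polynomial ℂ) :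
    ∃ C : ℝ, 0 ≤ C ∧ ∀ s : ℂ, ‖p.eval s‖ ≤ C * Real.exp ‖s‖ := by
  induction p using Polynomial.induction_on' with
  | add p q hp hq =>
    obtain ⟨C, hC, h⟩ := hp
    obtain ⟨C', hC', h'⟩ := hq
    refine ⟨C + C', by positivity, fun s => ?_⟩
    rw [Polynomial.eval_add, add_mul]
    exact (norm_add_le _ _).trans (add_le_add (h s) (h' s))
  | monomial n a =>
    refine ⟨‖a‖ * n.factorial, by positivity, fun s => ?_⟩
    rw [Polynomial.eval_monomial, norm_mul, norm_pow, mul_assoc]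
    gcongr
    have := Real.pow_div_factorial_le_exp ‖s‖ (norm_nonneg s) n
    rwa [div_le_iff₀ (by positivity), mul_comm] at this

/-- The error of Hermite interpolation of `exp (-s x)` at the nodes `P` by the idempotents `e`. -/
def hermiteError {r : ℕ} (P : Fin r → ℂ) (d : Fin r → ℕ) (e : Fin r → Polynomial ℂ) (x : ℂ)
    (s : ℂ) : ℂ :=
  Complex.exp (-(s * x)) - ∑ k, Complex.exp (-(P k * x)) *
    ∑ i ∈ Finset.range (d k), x ^ i * (expQuot i 0 * (-1) ^ i * (s - P k) ^ i * (e k).eval s)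

lemma exists_hermiteError_eq {r : ℕ} {P : Fin r → ℂ} {d : Fin r → ℕ} {e : Fin r → Polynomial ℂ}
    (he : ∀ k, (Polynomial.X - Polynomial.C (P k)) ^ d k ∣ 1 - e k)
    (he' : ∀ k l, l ≠ k → (Polynomial.X - Polynomial.C (P l)) ^ d l ∣ e k) (x : ℂ) (l : Fin r) :
    ∃ h : ℂ → ℂ, Differentiable ℂ h ∧
      ∀ s, hermiteError P d e x s = (s - P l) ^ d l * h s := by
  choose u hu using he
  have hv : ∀ k, ∃ v : Polynomial ℂ, l ≠ k →
      e k = (Polynomial.X - Polynomial.C (P l)) ^ d l * v := by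
    intro k
    by_cases hk : l = k
    · exact ⟨0, fun h => absurd hk h⟩
    · obtain ⟨v, hv⟩ := he' k l hk
      exact ⟨v, fun _ => hv⟩
  choose v hv using hv
  let S : Fin r → ℂ → ℂ := fun k s =>
    ∑ i ∈ Finset.range (d k), x ^ i * (expQuot i 0 * (-1) ^ i * (s - P k) ^ i)
  have hS : ∀ k, Differentiable ℂ (S k) := fun k => by
    simp only [S]; fun_prop
  have hS' : ∀ k s, ∑ i ∈ Finset.range (d k),
      x ^ i * (expQuot i 0 * (-1) ^ i * (s - P k) ^ i * (e k).eval s) = S k s * (e k).eval s := by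
    intro k s
    simp only [S, Finset.sum_mul]
    exact Finset.sum_congr rfl fun i _ => by ring
  refine ⟨fun s => Complex.exp (-(P l * x)) * ((-x) ^ d l * expQuot (d l) (-((s - P l) * x)))
    + Complex.exp (-(P l * x)) * S l s * (u l).eval s
    - ∑ k ∈ Finset.univ.erase l, Complex.exp (-(P k * x)) * S k s * (v k).eval s, ?_, ?_⟩
  · have h1 := differentiable_expQuot (d l)
    have h2 : ∀ p : Polynomial ℂ, Differentiable ℂ fun s => p.eval s := fun p => p.differentiable
    have h3 : Differentiable ℂ fun s => expQuot (d l) (-((s - P l) * x)) :=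
      h1.comp (by fun_prop)
    fun_prop
  · intro s
    have hexp : Complex.exp (-(s * x)) = Complex.exp (-(P l * x)) *
        (S l s + (s - P l) ^ d l * ((-x) ^ d l * expQuot (d l) (-((s - P l) * x)))) := by
      have h1 := exp_eq_sum_add_expQuot (d l) (-((s - P l) * x))
      have h2 : -(s * x) = -(P l * x) + -((s - P l) * x) := by ring
      rw [h2, Complex.exp_add, h1]
      congr 2
      · simp only [S]
        refine Finset.sum_congr rfl fun i _ => ?_
        rw [neg_pow, mul_pow]; ring
      · rw [neg_pow, mul_pow, neg_pow x]; ring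
    have hel : (e l).eval s = 1 - (s - P l) ^ d l * (u l).eval s := by
      have := congrArg (Polynomial.eval s) (hu l)
      simp at this
      linear_combination -this
    have hek : ∑ k ∈ Finset.univ.erase l, Complex.exp (-(P k * x)) * (S k s * (e k).eval s) =
        (s - P l) ^ d l *
          ∑ k ∈ Finset.univ.erase l, Complex.exp (-(P k * x)) * S k s * (v k).eval s := by
      rw [Finset.mul_sum]
      refine Finset.sum_congr rfl fun k hk => ?_
      have := congrArg (Polynomial.eval s) (hv k (Finset.ne_of_mem_erase hk).symm)
      simp at this
      rw [this]; ring
    simp only [hermiteError, hS']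
    rw [← Finset.add_sum_erase _ _ (Finset.mem_univ l), hek, hexp, hel]
    ring

lemma exists_gaussian_bound_mul {F w : ℂ → ℂ} {c' c κ D T C B : ℝ} (hκ : 0 < κ) (hC : 0 ≤ C)
    (hB : 0 ≤ B)
    (hb : ∀ s : ℂ, c' ≤ s.re → s.re ≤ c → T ≤ |s.im| →
      ‖F s‖ ≤ D * Real.exp (-(κ * s.im ^ 2)))
    (hw : ∀ s, ‖w s‖ ≤ C * Real.exp (B * ‖s‖)) :
    ∃ D' : ℝ, ∀ s : ℂ, c' ≤ s.re → s.re ≤ c → T ≤ |s.im| →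
      ‖F s * w s‖ ≤ D' * Real.exp (-(κ / 2 * s.im ^ 2)) := by
  refine ⟨|D| * C * Real.exp (B * (|c| + |c'|) + B ^ 2 / (2 * κ)), fun s h1 h2 h3 => ?_⟩
  have hre : |s.re| ≤ |c| + |c'| := by
    rw [abs_le]
    constructor
    · linarith [neg_abs_le c', abs_nonneg c]
    · linarith [le_abs_self c, abs_nonneg c']
  have hs : ‖s‖ ≤ (|c| + |c'|) + |s.im| := (Complex.norm_le_abs_re_add_abs_im s).trans (by linarith)
  have hquad : B * |s.im| ≤ κ / 2 * s.im ^ 2 + B ^ 2 / (2 * κ) := by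
    have h : 0 ≤ (κ * |s.im| - B) ^ 2 / (2 * κ) := by positivity
    have e : (κ * |s.im| - B) ^ 2 / (2 * κ) =
        κ / 2 * s.im ^ 2 + B ^ 2 / (2 * κ) - B * |s.im| := by
      rw [← sq_abs s.im]; field_simp; ring
    linarith
  have hexp : -(κ * s.im ^ 2) + B * ‖s‖ ≤
      (B * (|c| + |c'|) + B ^ 2 / (2 * κ)) + -(κ / 2 * s.im ^ 2) := by
    nlinarith [mul_le_mul_of_nonneg_left hs hB]
  calc ‖F s * w s‖ = ‖F s‖ * ‖w s‖ := norm_mul _ _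
    _ ≤ (|D| * Real.exp (-(κ * s.im ^ 2))) * (C * Real.exp (B * ‖s‖)) := by
        gcongr
        · refine (hb s h1 h2 h3).trans ?_
          gcongr
          exact le_abs_self D
        · exact hw s
    _ = |D| * C * Real.exp (-(κ * s.im ^ 2) + B * ‖s‖) := by rw [Real.exp_add]; ring
    _ ≤ |D| * C * Real.exp ((B * (|c| + |c'|) + B ^ 2 / (2 * κ)) + -(κ / 2 * s.im ^ 2)) := by
        gcongr
    _ = _ := by rw [Real.exp_add]; ring

lemma integrable_mul_vertical_line {F w : ℂ → ℂ} {c' c κ D T C B : ℝ} (hκ : 0 < κ) (hC : 0 ≤ C)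
    (hB : 0 ≤ B)
    (hb : ∀ s : ℂ, c' ≤ s.re → s.re ≤ c → T ≤ |s.im| →
      ‖F s‖ ≤ D * Real.exp (-(κ * s.im ^ 2)))
    (hw : ∀ s, ‖w s‖ ≤ C * Real.exp (B * ‖s‖)) (hwc : Continuous w) {σ : ℝ} (h1 : c' ≤ σ)
    (h2 : σ ≤ c) (hF : ∀ s : ℂ, s.re = σ → ContinuousAt F s) :
    Integrable fun t : ℝ => F (σ + t * I) * w (σ + t * I) := by
  obtain ⟨D', hD⟩ := exists_gaussian_bound_mul hκ hC hB hb hw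
  refine integrable_of_gaussian_bound (T := T) (D := D')
    (continuous_vertical_line (f := fun s => F s * w s)
      fun s hs => (hF s hs).mul hwc.continuousAt) (half_pos hκ) fun t ht => ?_
  simpa using hD (σ + t * I) (by simpa) (by simpa) (by simpa using ht)

lemma norm_exp_neg_mul_le (x s : ℂ) : ‖Complex.exp (-(s * x))‖ ≤ 1 * Real.exp (‖x‖ * ‖s‖) := by
  rw [one_mul, Complex.norm_exp]
  gcongr
  calc (-(s * x)).re ≤ ‖-(s * x)‖ := Complex.re_le_norm _
    _ = ‖x‖ * ‖s‖ := by rw [norm_neg, norm_mul, mul_comm]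

/-- Filling in the removable singularities of a product. -/
lemma exists_differentiableAt_extension {F H : ℂ → ℂ} {U : Set ℂ} {r : ℕ} {P : Fin r → ℂ}
    (hP : Function.Injective P) {d : Fin r → ℕ} (hH : Differentiable ℂ H)
    (hF : ∀ s ∈ U, s ∉ range P → DifferentiableAt ℂ F s)
    (hpole : ∀ k, ∃ g : ℂ → ℂ, DifferentiableAt ℂ g (P k) ∧
      ∀ᶠ s in nhdsWithin (P k) {P k}ᶜ, F s = g s / (s - P k) ^ d k)
    (hzero : ∀ k, ∃ h : ℂ → ℂ, Differentiable ℂ h ∧ ∀ s, H s = (s - P k) ^ d k * h s) :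
    ∃ Φ : ℂ → ℂ, (∀ s ∉ range P, Φ s = F s * H s) ∧ ∀ s ∈ U, DifferentiableAt ℂ Φ s := by
  classical
  choose g hg hgF using hpole
  choose h hh hhH using hzero
  let Φ : ℂ → ℂ := fun s => if hs : ∃ k, P k = s then g hs.choose s * h hs.choose s else F s * H s
  have hoff : ∀ s ∉ range P, Φ s = F s * H s := fun s hs => dif_neg hs
  have hon : ∀ k, Φ (P k) = g k (P k) * h k (P k) := by
    intro k
    have hs : ∃ l, P l = P k := ⟨k, rfl⟩
    have e : hs.choose = k := hP hs.choose_spec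
    simp only [Φ, dif_pos hs, e]
  refine ⟨Φ, hoff, fun s hsU => ?_⟩
  by_cases hs : s ∈ range P
  · obtain ⟨k, rfl⟩ := hs
    refine ((hg k).mul (hh k _)).congr_of_eventuallyEq ?_
    have hfin : (range P \ {P k}).Finite := (finite_range P).sdiff
    have h1 : ∀ᶠ s in nhds (P k), s ∈ (range P \ {P k})ᶜ :=
      hfin.isClosed.isOpen_compl.mem_nhds (by simp)
    filter_upwards [h1, eventually_nhdsWithin_iff.1 (hgF k)] with s hs1 hs2
    by_cases hsk : s = P k
    · rw [hsk]; exact hon k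
    · have hsr : s ∉ range P := fun hr => hs1 ⟨hr, hsk⟩
      have hne : (s - P k) ^ d k ≠ 0 := pow_ne_zero _ (sub_ne_zero.2 hsk)
      rw [hoff s hsr, hs2 hsk, hhH k s]
      simp only [Pi.mul_apply]
      field_simp
  · refine ((hF s hsU hs).mul (hH s)).congr_of_eventuallyEq ?_
    filter_upwards [(finite_range P).isClosed.isOpen_compl.mem_nhds hs] with u hu
    exact hoff u hu

/-- Shifting a vertical contour across finitely many poles: the residues of `F s * exp (-s x)` are
exponential polynomials in `x`. -/
lemma exists_integral_vertical_line_sub_eq_sum {F : ℂ → ℂ} {c' c : ℝ} (hcc : c' < c) {r : ℕ}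
    {P : Fin r → ℂ} (hP : Function.Injective P) (d : Fin r → ℕ)
    (hPc : ∀ k, c' < (P k).re ∧ (P k).re < c)
    (hF : ∀ s : ℂ, c' ≤ s.re → s.re ≤ c → s ∉ range P → DifferentiableAt ℂ F s)
    (hpole : ∀ k, ∃ g : ℂ → ℂ, DifferentiableAt ℂ g (P k) ∧
      ∀ᶠ s in nhdsWithin (P k) {P k}ᶜ, F s = g s / (s - P k) ^ d k)
    {κ D T : ℝ} (hκ : 0 < κ)
    (hb : ∀ s : ℂ, c' ≤ s.re → s.re ≤ c → T ≤ |s.im| →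
      ‖F s‖ ≤ D * Real.exp (-(κ * s.im ^ 2))) :
    ∃ A : Fin r → ℕ → ℂ, ∀ x : ℂ,
      (∫ t : ℝ, F (c + t * I) * Complex.exp (-((c + t * I) * x))) -
        ∫ t : ℝ, F (c' + t * I) * Complex.exp (-((c' + t * I) * x)) =
      ∑ k, Complex.exp (-(P k * x)) * ∑ i ∈ Finset.range (d k), A k i * x ^ i := by
  choose e he he' using exists_hermite_idempotent P hP d
  let Q : Fin r → ℕ → Polynomial ℂ := fun k i =>
    Polynomial.C (expQuot i 0 * (-1) ^ i) * (Polynomial.X - Polynomial.C (P k)) ^ i * e k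
  have hQ : ∀ x s, hermiteError P d e x s = Complex.exp (-(s * x)) -
      ∑ k, Complex.exp (-(P k * x)) * ∑ i ∈ Finset.range (d k), x ^ i * (Q k i).eval s := by
    intro x s
    simp [hermiteError, Q]
  have hcont : ∀ σ : ℝ, (σ = c ∨ σ = c') → ∀ s : ℂ, s.re = σ → ContinuousAt F s := by
    intro σ hσ s hs
    refine (hF s ?_ ?_ ?_).continuousAt
    · rcases hσ with h | h <;> rw [hs, h]; exact hcc.le
    · rcases hσ with h | h <;> rw [hs, h]; exact hcc.le
    · rintro ⟨k, rfl⟩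
      have := hPc k
      rcases hσ with h | h <;> rw [hs, h] at this
      · exact lt_irrefl _ this.2
      · exact lt_irrefl _ this.1
  have hmem : ∀ σ : ℝ, (σ = c ∨ σ = c') → c' ≤ σ ∧ σ ≤ c := by
    rintro σ (rfl | rfl)
    · exact ⟨hcc.le, le_rfl⟩
    · exact ⟨le_rfl, hcc.le⟩
  have hintQ : ∀ σ : ℝ, (σ = c ∨ σ = c') → ∀ k i,
      Integrable fun t : ℝ => F (σ + t * I) * (Q k i).eval (σ + t * I) := by
    intro σ hσ k i
    obtain ⟨C, hC, hQC⟩ := Polynomial.exists_norm_eval_le (Q k i)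
    exact integrable_mul_vertical_line (w := fun s => (Q k i).eval s) hκ hC zero_le_one hb
      (by simpa using hQC) (Q k i).continuous (hmem σ hσ).1 (hmem σ hσ).2 (hcont σ hσ)
  have hintE : ∀ σ : ℝ, (σ = c ∨ σ = c') → ∀ x : ℂ,
      Integrable fun t : ℝ => F (σ + t * I) * Complex.exp (-((σ + t * I) * x)) := by
    intro σ hσ x
    exact integrable_mul_vertical_line (w := fun s => Complex.exp (-(s * x))) hκ zero_le_one
      (norm_nonneg x) hb (norm_exp_neg_mul_le x) (by fun_prop) (hmem σ hσ).1 (hmem σ hσ).2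
      (hcont σ hσ)
  have hlin : ∀ σ : ℝ, (σ = c ∨ σ = c') → ∀ x : ℂ,
      ∫ t : ℝ, F (σ + t * I) * hermiteError P d e x (σ + t * I) =
        (∫ t : ℝ, F (σ + t * I) * Complex.exp (-((σ + t * I) * x))) -
        ∑ k, Complex.exp (-(P k * x)) * ∑ i ∈ Finset.range (d k),
          x ^ i * ∫ t : ℝ, F (σ + t * I) * (Q k i).eval (σ + t * I) := by
    intro σ hσ x
    have e1 : ∀ t : ℝ, F (σ + t * I) * hermiteError P d e x (σ + t * I) =
        F (σ + t * I) * Complex.exp (-((σ + t * I) * x)) -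
        ∑ k, ∑ i ∈ Finset.range (d k), Complex.exp (-(P k * x)) * x ^ i *
          (F (σ + t * I) * (Q k i).eval (σ + t * I)) := by
      intro t
      rw [hQ, mul_sub, Finset.mul_sum]
      congr 1
      refine Finset.sum_congr rfl fun k _ => ?_
      rw [Finset.mul_sum, Finset.mul_sum]
      exact Finset.sum_congr rfl fun i _ => by ring
    have hi : ∀ k i, Integrable fun t : ℝ => Complex.exp (-(P k * x)) * x ^ i *
          (F (σ + t * I) * (Q k i).eval (σ + t * I)) := fun k i => (hintQ σ hσ k i).const_mul _
    simp_rw [e1]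
    rw [integral_sub (hintE σ hσ x)
      (integrable_finsetSum _ fun k _ => integrable_finsetSum _ fun i _ => hi k i)]
    congr 1
    rw [integral_finsetSum _ fun k _ => integrable_finsetSum _ fun i _ => hi k i]
    refine Finset.sum_congr rfl fun k _ => ?_
    rw [integral_finsetSum _ fun i _ => hi k i, Finset.mul_sum]
    refine Finset.sum_congr rfl fun i _ => ?_
    rw [integral_const_mul]
    ring
  refine ⟨fun k i => (∫ t : ℝ, F (c + t * I) * (Q k i).eval (c + t * I)) -
    ∫ t : ℝ, F (c' + t * I) * (Q k i).eval (c' + t * I), fun x => ?_⟩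
  obtain ⟨Φ, hΦ, hΦd⟩ := exists_differentiableAt_extension (U := {s : ℂ | c' ≤ s.re ∧ s.re ≤ c})
    (H := hermiteError P d e x) (d := d) hP
    (by
      have h2 : ∀ p : Polynomial ℂ, Differentiable ℂ fun s => p.eval s := fun p => p.differentiable
      have : hermiteError P d e x = fun s => _ := funext (hQ x)
      rw [this]
      fun_prop)
    (fun s hs hsP => hF s hs.1 hs.2 hsP) hpole (fun k => exists_hermiteError_eq he he' x k)
  have hbound : ∃ C B : ℝ, 0 ≤ C ∧ 0 ≤ B ∧
      ∀ s, ‖hermiteError P d e x s‖ ≤ C * Real.exp (B * ‖s‖) := by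
    let R : Polynomial ℂ := ∑ k, ∑ i ∈ Finset.range (d k),
      Polynomial.C (Complex.exp (-(P k * x)) * x ^ i) * Q k i
    obtain ⟨C, hC, hR⟩ := Polynomial.exists_norm_eval_le R
    refine ⟨1 + C, 1 + ‖x‖, by positivity, by positivity, fun s => ?_⟩
    have e1 : hermiteError P d e x s = Complex.exp (-(s * x)) - R.eval s := by
      rw [hQ]
      simp only [R, Polynomial.eval_finsetSum, Polynomial.eval_mul, Polynomial.eval_C,
        Finset.mul_sum, mul_assoc]
    rw [e1, add_mul]
    refine (norm_sub_le _ _).trans (add_le_add ((norm_exp_neg_mul_le x s).trans ?_)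
      ((hR s).trans ?_))
    · gcongr; linarith
    · gcongr; nlinarith [norm_nonneg s, norm_nonneg x]
  obtain ⟨C, B, hC, hB, hCB⟩ := hbound
  obtain ⟨D', hD'⟩ := exists_gaussian_bound_mul hκ hC hB hb hCB
  have hshift := integral_vertical_line_eq hcc.le (fun s h1 h2 => hΦd s ⟨h1, h2⟩)
    (T := max T (∑ k, |(P k).im| + 1)) (D := D') (half_pos hκ) (fun s h1 h2 h3 => by
      have hsP : s ∉ range P := by
        rintro ⟨k, rfl⟩
        have h4 := (le_max_right _ _).trans h3
        have h5 := Finset.single_le_sum (f := fun k => |(P k).im|) (fun _ _ => abs_nonneg _)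
          (Finset.mem_univ k)
        linarith
      rw [hΦ s hsP]
      exact hD' s h1 h2 ((le_max_left _ _).trans h3))
  have hcongr : ∀ σ : ℝ, (σ = c ∨ σ = c') →
      ∫ t : ℝ, Φ (σ + t * I) = ∫ t : ℝ, F (σ + t * I) * hermiteError P d e x (σ + t * I) := by
    intro σ hσ
    refine integral_congr_ae (Eventually.of_forall fun t => hΦ _ ?_)
    rintro ⟨k, hk⟩
    have h1 := hPc k
    rw [hk] at h1
    simp at h1
    rcases hσ with h | h
    · exact h1.2.ne h
    · exact h1.1.ne' h
  rw [hcongr c (Or.inl rfl), hcongr c' (Or.inr rfl), hlin c (Or.inl rfl), hlin c' (Or.inr rfl)]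
    at hshift
  rw [sub_eq_sub_iff_add_eq_add] at hshift
  have e2 : ∑ k, Complex.exp (-(P k * x)) * ∑ i ∈ Finset.range (d k),
      ((∫ t : ℝ, F (c + t * I) * (Q k i).eval (c + t * I)) -
        ∫ t : ℝ, F (c' + t * I) * (Q k i).eval (c' + t * I)) * x ^ i =
      (∑ k, Complex.exp (-(P k * x)) * ∑ i ∈ Finset.range (d k),
          x ^ i * ∫ t : ℝ, F (c + t * I) * (Q k i).eval (c + t * I)) -
      ∑ k, Complex.exp (-(P k * x)) * ∑ i ∈ Finset.range (d k),
          x ^ i * ∫ t : ℝ, F (c' + t * I) * (Q k i).eval (c' + t * I) := by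
    rw [← Finset.sum_sub_distrib]
    refine Finset.sum_congr rfl fun k _ => ?_
    rw [← mul_sub, ← Finset.sum_sub_distrib]
    congr 1
    exact Finset.sum_congr rfl fun i _ => by ring
  rw [e2]
  linear_combination hshift

lemma barnesG_eq_latticeProd (τ : ℝ) (z : ℂ) : barnesG z τ =
    z / τ * Complex.exp (aBarnes τ * z / τ + bBarnes τ * z ^ 2 / (2 * τ)) * latticeProd τ z := by
  unfold barnesG latticeProd
  congr 1
  refine tprod_congr fun x => ?_
  split_ifs with hx
  · rw [hx, latticePt_zero]; simp [elemFactor_zero]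
  · simp [elemFactor, latticePt, div_pow, div_div, mul_comm]

lemma differentiable_barnesG {τ : ℝ} (hτ : 0 < τ) : Differentiable ℂ fun z => barnesG z τ := by
  have := differentiable_latticeProd hτ
  simp only [barnesG_eq_latticeProd]
  fun_prop

lemma barnesG_ne_zero {τ : ℝ} (hτ : 0 < τ) {z : ℂ}
    (hz : ∀ x : ℕ × ℕ, z + latticePt τ x ≠ 0) : barnesG z τ ≠ 0 := by
  rw [barnesG_eq_latticeProd]
  have hz0 : z ≠ 0 := by simpa [latticePt_zero] using hz (0, 0)
  have : (τ : ℂ) ≠ 0 := by exact_mod_cast hτ.ne'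
  exact mul_ne_zero (mul_ne_zero (div_ne_zero hz0 this) (Complex.exp_ne_zero _))
    (latticeProd_ne_zero hτ fun x _ => hz x)

/-- The size of `barnesG (± t * I) τ`, up to subexponential corrections. -/
def barnesSize (τ t : ℝ) : ℝ :=
  ‖latticeProd τ (t * I)‖ * Real.exp (-((bBarnes τ).re * t ^ 2 / (2 * τ)))

lemma barnesSize_pos {τ : ℝ} (hτ : 0 < τ) {t : ℝ} (ht : t ≠ 0) : 0 < barnesSize τ t := by
  refine mul_pos (norm_pos_iff.2 (latticeProd_ne_zero hτ fun x _ h => ht ?_)) (Real.exp_pos _)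
  simpa using congrArg Complex.im h

lemma barnesSize_eq (τ : ℝ) {w : ℂ} (hw : w.re = 0) :
    barnesSize τ w.im =
      ‖latticeProd τ w‖ * Real.exp ((bBarnes τ * w ^ 2 / (2 * τ)).re) := by
  have e : w = w.im * I := Complex.ext (by simp [hw]) (by simp)
  have e2 : bBarnes τ * w ^ 2 / (2 * τ) = ((-(w.im ^ 2 / (2 * τ)) : ℝ) : ℂ) * bBarnes τ := by
    rw [e, mul_pow, I_sq]; push_cast; simp; ring
  rw [barnesSize, ← e, e2, re_ofReal_mul]
  congr 2
  ring

lemma barnesSize_neg {τ : ℝ} (hτ : 0 < τ) (t : ℝ) : barnesSize τ (-t) = barnesSize τ t := by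
  unfold barnesSize
  have := norm_latticeProd_neg_mul_I hτ t
  rw [← this]
  simp

lemma barnesG_bounds {τ : ℝ} (hτ : 0 < τ) {R : ℝ} (hR : 0 ≤ R) :
    ∃ C : ℝ, 0 ≤ C ∧ ∀ z w : ℂ, w.re = 0 → 1 + R ≤ |w.im| → ‖z - w‖ ≤ R →
      ‖barnesG z τ‖ ≤ barnesSize τ w.im * Real.exp (C * (|w.im| * √|w.im|)) ∧
      barnesSize τ w.im ≤ ‖barnesG z τ‖ * Real.exp (C * (|w.im| * √|w.im|)) := by
  obtain ⟨C, hC, h⟩ := norm_latticeProd_le hτ hR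
  set K := ‖aBarnes τ‖ * 2 / τ + ‖bBarnes τ‖ * (3 * R) / (2 * τ) with hK
  have hK0 : 0 ≤ K := by positivity
  refine ⟨4 * C + K + 2 / τ + τ, by positivity, fun z w hw hwR hzw => ?_⟩
  set y := |w.im| with hy
  have hy1 : 1 ≤ y := by linarith
  have hwn : ‖w‖ = y := by
    have e : w = w.im * I := Complex.ext (by simp [hw]) (by simp)
    rw [e]; simp [hy]
  have hzn : ‖z‖ ≤ 2 * y := by
    have := norm_add_le (z - w) w
    rw [sub_add_cancel] at this
    linarith
  have hzim : 1 ≤ |z.im| := by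
    have h1 := Complex.abs_im_le_norm (z - w)
    have h2 := abs_sub_abs_le_abs_sub w.im z.im
    rw [sub_im, abs_sub_comm] at h1
    linarith
  have hz1 : 1 ≤ ‖z‖ := hzim.trans (Complex.abs_im_le_norm z)
  have hzre : |z.re| ≤ R := by
    have h1 := Complex.abs_re_le_norm (z - w)
    rw [sub_re, hw, sub_zero] at h1
    linarith
  have hyy : y ≤ y * √y := le_mul_of_one_le_right (by linarith) (Real.one_le_sqrt.2 hy1)
  have hyy0 : 0 ≤ y * √y := by positivity
  have hup := h z w (by rw [hw]; simpa using hR) (by linarith) hzw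
  have hlo := h w z hzre hzim (by rwa [norm_sub_rev])
  rw [hwn] at hup
  have hzz : ‖z‖ * √‖z‖ ≤ 4 * (y * √y) := by
    have h1 : √‖z‖ ≤ 2 * √y := by
      rw [Real.sqrt_le_left (by positivity), mul_pow, Real.sq_sqrt (by linarith)]
      linarith
    calc ‖z‖ * √‖z‖ ≤ (2 * y) * (2 * √y) := by gcongr
      _ = _ := by ring
  have hE : |(aBarnes τ * z / τ + bBarnes τ * z ^ 2 / (2 * τ)).re -
      (bBarnes τ * w ^ 2 / (2 * τ)).re| ≤ K * y := by
    rw [← sub_re]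
    refine (Complex.abs_re_le_norm _).trans ?_
    have e : aBarnes τ * z / τ + bBarnes τ * z ^ 2 / (2 * τ) - bBarnes τ * w ^ 2 / (2 * τ) =
        aBarnes τ * z / τ + bBarnes τ * ((z - w) * (z + w)) / (2 * τ) := by ring
    rw [e]
    refine (norm_add_le _ _).trans ?_
    simp only [norm_div, norm_mul, Complex.norm_real, Real.norm_of_nonneg hτ.le,
      Complex.norm_ofNat]
    have h1 : ‖z + w‖ ≤ 3 * y := (norm_add_le _ _).trans (by linarith)
    calc ‖aBarnes τ‖ * ‖z‖ / τ + ‖bBarnes τ‖ * (‖z - w‖ * ‖z + w‖) / (2 * τ)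
        ≤ ‖aBarnes τ‖ * (2 * y) / τ + ‖bBarnes τ‖ * (R * (3 * y)) / (2 * τ) := by gcongr
      _ = K * y := by rw [hK]; ring
  rw [abs_le] at hE
  clear_value K
  have hG : ‖barnesG z τ‖ = ‖z‖ / τ *
      Real.exp ((aBarnes τ * z / τ + bBarnes τ * z ^ 2 / (2 * τ)).re) * ‖latticeProd τ z‖ := by
    rw [barnesG_eq_latticeProd, norm_mul, norm_mul, norm_div, Complex.norm_exp, Complex.norm_real,
      Real.norm_of_nonneg hτ.le]
  rw [hG, barnesSize_eq τ hw]
  set e1 := (aBarnes τ * z / τ + bBarnes τ * z ^ 2 / (2 * τ)).re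
  set e2 := (bBarnes τ * w ^ 2 / (2 * τ)).re
  have hτ2 : 0 ≤ 2 / τ := by positivity
  constructor
  · have h1 : ‖z‖ / τ ≤ Real.exp (2 / τ * y) := by
      calc ‖z‖ / τ ≤ 2 * y / τ := by gcongr
        _ = 2 / τ * y := by ring
        _ ≤ Real.exp (2 / τ * y) := by linarith [Real.add_one_le_exp (2 / τ * y)]
    calc ‖z‖ / τ * Real.exp e1 * ‖latticeProd τ z‖
        ≤ Real.exp (2 / τ * y) * Real.exp (e2 + K * y) *
          (Real.exp (C * (y * √y)) * ‖latticeProd τ w‖) := by gcongr; linarith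
      _ = ‖latticeProd τ w‖ * Real.exp e2 * Real.exp ((2 / τ + K) * y + C * (y * √y)) := by
          simp only [add_mul, Real.exp_add]; ring
      _ ≤ _ := by
          gcongr
          nlinarith [mul_le_mul_of_nonneg_left hyy (add_nonneg hτ2 hK0),
            mul_nonneg hC hyy0, mul_nonneg hτ.le hyy0]
  · have h1 : 1 ≤ ‖z‖ / τ * Real.exp (τ * y) := by
      rw [div_mul_eq_mul_div, le_div_iff₀ hτ, one_mul]
      have h2 : τ ≤ Real.exp (τ * y) := by
        nlinarith [Real.add_one_le_exp (τ * y)]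
      nlinarith [Real.exp_pos (τ * y)]
    calc ‖latticeProd τ w‖ * Real.exp e2
        ≤ (Real.exp (C * (‖z‖ * √‖z‖)) * ‖latticeProd τ z‖) * Real.exp (e1 + K * y) := by
          gcongr; linarith
      _ ≤ (Real.exp (C * (4 * (y * √y))) * ‖latticeProd τ z‖) * Real.exp (e1 + K * y) *
          (‖z‖ / τ * Real.exp (τ * y)) := by
          refine le_trans ?_ (le_mul_of_one_le_right (by positivity) h1)
          gcongr
      _ = ‖z‖ / τ * Real.exp e1 * ‖latticeProd τ z‖ *
          Real.exp ((τ + K) * y + C * (4 * (y * √y))) := by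
          simp only [add_mul, Real.exp_add]; ring
      _ ≤ _ := by
          gcongr
          nlinarith [mul_le_mul_of_nonneg_left hyy (add_nonneg hτ.le hK0),
            mul_nonneg hC hyy0, mul_nonneg hτ2 hyy0]

lemma exists_barnesSize_le {τ : ℝ} (hτ : 0 < τ) (K : ℝ) :
    ∃ T : ℝ, ∀ t : ℝ, T ≤ |t| → barnesSize τ t ≤ Real.exp (-(K * t ^ 2)) := by
  obtain ⟨T, hT⟩ := norm_latticeProd_mul_I_le hτ (K - (bBarnes τ).re / (2 * τ))
  refine ⟨T, fun t ht => ?_⟩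
  calc barnesSize τ t ≤ Real.exp (-((K - (bBarnes τ).re / (2 * τ)) * t ^ 2)) *
      Real.exp (-((bBarnes τ).re * t ^ 2 / (2 * τ))) := by
        unfold barnesSize; gcongr; exact hT t ht
    _ = _ := by rw [← Real.exp_add]; congr 1; ring

lemma Fin.prod_ite_val_lt {q m : ℕ} (hm : m ≤ q) (x : ℝ) :
    ∏ j : Fin q, (if (j : ℕ) < m then x else 1) = x ^ m := by
  rw [Finset.prod_ite, Finset.prod_const, Finset.prod_const_one, mul_one,
    Fin.card_filter_val_lt, min_eq_right hm]

lemma Fin.prod_ite_le_val {q m : ℕ} (hm : m ≤ q) (x : ℝ) :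
    ∏ j : Fin q, (if m ≤ (j : ℕ) then x else 1) = x ^ (q - m) := by
  rw [Finset.prod_ite, Finset.prod_const, Finset.prod_const_one, mul_one]
  congr 1
  have h := Finset.card_filter_add_card_filter_not (s := (Finset.univ : Finset (Fin q)))
    (fun j : Fin q => (j : ℕ) < m)
  simp only [not_lt, Finset.card_univ, Fintype.card_fin] at h
  rw [Fin.card_filter_val_lt, min_eq_right hm] at h
  omega

lemma norm_calG_le {τ : ℝ} (hτ : 0 < τ) {m n p q : ℕ} (hm : m ≤ q) (hn : n ≤ p)
    (a : Fin p → ℂ) (b : Fin q → ℂ) {S : ℝ} (hS : 0 ≤ S) {N : ℕ} (hN : paramN m n p q = N) :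
    ∃ C T : ℝ, 0 ≤ C ∧ 1 ≤ T ∧ ∀ s : ℂ, |s.re| ≤ S → T ≤ |s.im| →
      ‖calG m n a b s τ‖ ≤ barnesSize τ s.im ^ N * Real.exp (C * (|s.im| * √|s.im|)) := by
  set R := (∑ j, ‖b j‖) + (∑ j, ‖a j‖) + (1 + τ) + S with hR
  have hR0 : 0 ≤ R := by positivity
  obtain ⟨C, hC, h⟩ := barnesG_bounds hτ hR0
  refine ⟨C * (p + q), 1 + R, by positivity, by linarith, fun s hs ht => ?_⟩
  set t := s.im with htdef
  set B := barnesSize τ t with hB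
  set E := Real.exp (C * (|t| * √|t|)) with hE
  have hE0 : 0 < E := Real.exp_pos _
  have ht0 : t ≠ 0 := by
    intro h0
    rw [h0, abs_zero] at ht
    linarith
  have hB0 : 0 < B := barnesSize_pos hτ ht0
  have hbj : ∀ j, ‖b j‖ ≤ ∑ j, ‖b j‖ := fun j =>
    Finset.single_le_sum (f := fun j => ‖b j‖) (fun _ _ => norm_nonneg _) (Finset.mem_univ j)
  have haj : ∀ j, ‖a j‖ ≤ ∑ j, ‖a j‖ := fun j =>
    Finset.single_le_sum (f := fun j => ‖a j‖) (fun _ _ => norm_nonneg _) (Finset.mem_univ j)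
  have hsb : 0 ≤ ∑ j, ‖b j‖ := Finset.sum_nonneg fun _ _ => norm_nonneg _
  have hsa : 0 ≤ ∑ j, ‖a j‖ := Finset.sum_nonneg fun _ _ => norm_nonneg _
  have hsub : ∀ u : ℂ, ‖u‖ ≤ (∑ j, ‖b j‖) + ∑ j, ‖a j‖ →
      ‖barnesG (u - s) τ‖ ≤ B * E ∧ B * E⁻¹ ≤ ‖barnesG (u - s) τ‖ := by
    intro u hu
    have h1 : ‖u - s - ((-t : ℝ) : ℂ) * I‖ ≤ R := by
      have e : u - s - ((-t : ℝ) : ℂ) * I = u - (s.re : ℂ) := by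
        nth_rewrite 1 [← Complex.re_add_im s]
        push_cast; ring
      rw [e]
      refine (norm_sub_le _ _).trans ?_
      rw [Complex.norm_real, Real.norm_eq_abs]
      linarith
    have h2 := h (u - s) (((-t : ℝ) : ℂ) * I) (by simp) (by simpa using ht) h1
    have e : (((-t : ℝ) : ℂ) * I).im = -t := by simp
    rw [e, abs_neg, barnesSize_neg hτ] at h2
    exact ⟨h2.1, by rw [← div_eq_mul_inv, div_le_iff₀ hE0]; exact h2.2⟩
  have hadd : ∀ u : ℂ, ‖u‖ ≤ (∑ j, ‖b j‖) + ∑ j, ‖a j‖ →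
      ‖barnesG (1 + τ - u + s) τ‖ ≤ B * E ∧ B * E⁻¹ ≤ ‖barnesG (1 + τ - u + s) τ‖ := by
    intro u hu
    have h1 : ‖1 + τ - u + s - (t : ℂ) * I‖ ≤ R := by
      have e : 1 + τ - u + s - (t : ℂ) * I = (1 + τ : ℝ) - u + (s.re : ℂ) := by
        nth_rewrite 1 [← Complex.re_add_im s]
        push_cast; ring
      rw [e]
      refine (norm_add_le _ _).trans ?_
      have h3 := norm_sub_le ((1 + τ : ℝ) : ℂ) u
      rw [Complex.norm_real, Real.norm_of_nonneg (by linarith : (0 : ℝ) ≤ 1 + τ)] at h3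
      rw [Complex.norm_real, Real.norm_eq_abs]
      linarith
    have h2 := h (1 + τ - u + s) ((t : ℂ) * I) (by simp) (by simpa using ht) h1
    have e : ((t : ℂ) * I).im = t := by simp
    rw [e] at h2
    exact ⟨h2.1, by rw [← div_eq_mul_inv, div_le_iff₀ hE0]; exact h2.2⟩
  have hnum : ∀ {l k : ℕ} (hk : k ≤ l) (f : Fin l → ℂ), (∀ j, ‖f j‖ ≤ B * E) →
      ‖∏ j : Fin l, (if (j : ℕ) < k then f j else 1)‖ ≤ (B * E) ^ k := by
    intro l k hk f hf
    rw [norm_prod, ← Fin.prod_ite_val_lt hk]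
    refine Finset.prod_le_prod (fun _ _ => norm_nonneg _) fun j _ => ?_
    split_ifs
    · exact hf j
    · simp
  have hden : ∀ {l k : ℕ} (hk : k ≤ l) (f : Fin l → ℂ), (∀ j, B * E⁻¹ ≤ ‖f j‖) →
      (B * E⁻¹) ^ (l - k) ≤ ‖∏ j : Fin l, (if k ≤ (j : ℕ) then f j else 1)‖ := by
    intro l k hk f hf
    rw [norm_prod, ← Fin.prod_ite_le_val hk]
    refine Finset.prod_le_prod (fun _ _ => by split_ifs <;> positivity) fun j _ => ?_
    split_ifs
    · exact hf j
    · simp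
  have hcount : m + n = N + ((q - m) + (p - n)) := by
    unfold paramN at hN
    omega
  have hcount2 : (m + n) + ((q - m) + (p - n)) = p + q := by omega
  unfold calG
  rw [norm_div, norm_mul, norm_mul]
  calc _ ≤ ((B * E) ^ m * (B * E) ^ n) / ((B * E⁻¹) ^ (q - m) * (B * E⁻¹) ^ (p - n)) := by
        gcongr
        · exact hnum hm _ fun j => (hsub _ (by linarith [hbj j])).1
        · exact hnum hn _ fun j => (hadd _ (by linarith [haj j])).1
        · exact hden hm _ fun j => (hadd _ (by linarith [hbj j])).2
        · exact hden hn _ fun j => (hsub _ (by linarith [haj j])).2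
    _ = B ^ N * E ^ (p + q) := by
        rw [← pow_add, ← pow_add, mul_pow, mul_pow, inv_pow, ← hcount2, pow_add E, div_eq_iff
          (by positivity)]
        have : B ^ (m + n) = B ^ N * B ^ ((q - m) + (p - n)) := by rw [← pow_add, ← hcount]
        rw [this]
        have h2 : E ^ ((q - m) + (p - n)) ≠ 0 := by positivity
        field_simp
        rw [← pow_add, ← pow_add]
    _ = _ := by
        rw [hE, ← Real.exp_nat_mul]
        congr 2
        push_cast; ring

lemma exists_mul_sqrt_le {K ε : ℝ} (hK : 0 ≤ K) (hε : 0 < ε) :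
    ∃ D : ℝ, ∀ t : ℝ, K * (|t| * √|t|) ≤ ε * t ^ 2 + D := by
  refine ⟨K * (K / ε) ^ 3, fun t => ?_⟩
  set y := √|t| with hy
  have hy0 : 0 ≤ y := Real.sqrt_nonneg _
  have ht : |t| = y ^ 2 := (Real.sq_sqrt (abs_nonneg t)).symm
  rw [← sq_abs t, ht]
  rcases le_total (K / ε) y with h | h
  · rw [div_le_iff₀ hε] at h
    have h1 : 0 ≤ K * (K / ε) ^ 3 := by positivity
    have h2 := mul_le_mul_of_nonneg_right h (pow_nonneg hy0 3)
    nlinarith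
  · have h1 : K * y ^ 3 ≤ K * (K / ε) ^ 3 := by gcongr
    have h2 : 0 ≤ ε * (y ^ 2) ^ 2 := by positivity
    nlinarith

/-- Gaussian decay of the integrand of the `K`-function in vertical strips. -/
lemma exists_calG_gaussian_bound {τ : ℝ} (hτ : 0 < τ) (α : ℂ) {m n p q : ℕ} (hm : m ≤ q)
    (hn : n ≤ p) (a : Fin p → ℂ) (b : Fin q → ℂ)
    (hcase : 0 < paramN m n p q ∨ (paramN m n p q = 0 ∧ 0 < α.re)) (c' c : ℝ) :
    ∃ κ D T : ℝ, 0 < κ ∧ ∀ s : ℂ, c' ≤ s.re → s.re ≤ c → T ≤ |s.im| →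
      ‖calG m n a b s τ * Complex.exp ((Real.pi : ℂ) * α / τ * s ^ 2)‖ ≤
        D * Real.exp (-(κ * s.im ^ 2)) := by
  set S := |c| + |c'| with hS
  have hS0 : 0 ≤ S := by positivity
  obtain ⟨N, hN⟩ : ∃ N : ℕ, paramN m n p q = N :=
    Int.eq_ofNat_of_zero_le (by rcases hcase with h | h <;> omega)
  obtain ⟨C, T₁, hC, hT₁, hG⟩ := norm_calG_le hτ hm hn a b hS0 hN
  set β := (Real.pi : ℂ) * α / τ with hβ
  have hβre : β.re = Real.pi * α.re / τ := by
    have : β = ((Real.pi / τ : ℝ) : ℂ) * α := by rw [hβ]; push_cast; ring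
    rw [this, re_ofReal_mul]; ring
  -- the decay coming from the leading term
  obtain ⟨κ, T₂, hκ, hlead⟩ : ∃ κ T₂ : ℝ, 0 < κ ∧ ∀ t : ℝ, t ≠ 0 → T₂ ≤ |t| →
      barnesSize τ t ^ N * Real.exp (-(β.re * t ^ 2)) ≤ Real.exp (-(κ * t ^ 2)) := by
    rcases hcase with h | ⟨h, hα⟩
    · have hN1 : N ≠ 0 := by rintro rfl; rw [hN] at h; simp at h
      obtain ⟨T, hT⟩ := exists_barnesSize_le hτ (1 + |β.re|)
      refine ⟨1, T, one_pos, fun t ht0 ht => ?_⟩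
      have h1 := hT t ht
      have h2 : barnesSize τ t ≤ 1 := h1.trans (Real.exp_le_one_iff.2 (by
        have : 0 ≤ (1 + |β.re|) * t ^ 2 := by positivity
        linarith))
      calc barnesSize τ t ^ N * Real.exp (-(β.re * t ^ 2))
          ≤ Real.exp (-((1 + |β.re|) * t ^ 2)) * Real.exp (-(β.re * t ^ 2)) := by
            gcongr
            exact (pow_le_of_le_one (barnesSize_pos hτ ht0).le h2 hN1).trans h1
        _ ≤ Real.exp (-(1 * t ^ 2)) := by
            rw [← Real.exp_add]
            gcongr
            nlinarith [neg_abs_le β.re, sq_nonneg t]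
    · have hN0 : N = 0 := by rw [hN] at h; exact_mod_cast h
      refine ⟨β.re, 0, by rw [hβre]; positivity, fun t _ _ => ?_⟩
      rw [hN0, pow_zero, one_mul]
  obtain ⟨D, hD⟩ := exists_mul_sqrt_le (K := C + 2 * ‖β‖ * S) (by positivity) (half_pos hκ)
  refine ⟨κ / 2, Real.exp (D + ‖β‖ * S ^ 2), max T₁ T₂, half_pos hκ, fun s h1 h2 h3 => ?_⟩
  have ht1 : T₁ ≤ |s.im| := (le_max_left _ _).trans h3
  have ht2 : T₂ ≤ |s.im| := (le_max_right _ _).trans h3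
  have hsre : |s.re| ≤ S := by
    rw [abs_le]
    constructor
    · linarith [neg_abs_le c', abs_nonneg c]
    · linarith [le_abs_self c, abs_nonneg c']
  have hy1 : 1 ≤ |s.im| := hT₁.trans ht1
  have ht0 : s.im ≠ 0 := by
    intro h0; rw [h0, abs_zero] at hy1; linarith
  have hyy : |s.im| ≤ |s.im| * √|s.im| :=
    le_mul_of_one_le_right (by linarith) (Real.one_le_sqrt.2 hy1)
  have hexp : (β * s ^ 2).re ≤
      -(β.re * s.im ^ 2) + (‖β‖ * S ^ 2 + 2 * ‖β‖ * S * (|s.im| * √|s.im|)) := by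
    have e : (β * s ^ 2).re = -(β.re * s.im ^ 2) + (β.re * s.re ^ 2 -
        2 * β.im * (s.re * s.im)) := by
      simp [pow_two]; ring
    rw [e]
    have h4 : β.re * s.re ^ 2 ≤ ‖β‖ * S ^ 2 := by
      rw [← sq_abs s.re]
      gcongr
      exact Complex.re_le_norm β
    have h5 : -(2 * β.im * (s.re * s.im)) ≤ 2 * ‖β‖ * S * (|s.im| * √|s.im|) := by
      calc -(2 * β.im * (s.re * s.im)) ≤ |2 * β.im * (s.re * s.im)| := neg_le_abs _
        _ = 2 * |β.im| * (|s.re| * |s.im|) := by simp [abs_mul]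
        _ ≤ 2 * ‖β‖ * (S * (|s.im| * √|s.im|)) := by
          gcongr
          exact Complex.abs_im_le_norm β
        _ = _ := by ring
    linarith
  rw [norm_mul, Complex.norm_exp]
  calc ‖calG m n a b s τ‖ * Real.exp (β * s ^ 2).re
      ≤ (barnesSize τ s.im ^ N * Real.exp (C * (|s.im| * √|s.im|))) *
        Real.exp (-(β.re * s.im ^ 2) +
          (‖β‖ * S ^ 2 + 2 * ‖β‖ * S * (|s.im| * √|s.im|))) := by
        have := hG s hsre ht1
        have hB0 := (barnesSize_pos hτ ht0).le
        gcongr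
    _ = (barnesSize τ s.im ^ N * Real.exp (-(β.re * s.im ^ 2))) *
        Real.exp (‖β‖ * S ^ 2 + (C + 2 * ‖β‖ * S) * (|s.im| * √|s.im|)) := by
        simp only [add_mul, Real.exp_add]; ring
    _ ≤ Real.exp (-(κ * s.im ^ 2)) * Real.exp (‖β‖ * S ^ 2 + (κ / 2 * s.im ^ 2 + D)) := by
        gcongr
        · exact hlead _ ht0 ht2
        · exact hD _
    _ = _ := by
        rw [← Real.exp_add, ← Real.exp_add]; congr 1; ring

lemma differentiableAt_calG {τ : ℝ} (hτ : 0 < τ) {m n p q : ℕ} {a : Fin p → ℂ} {b : Fin q → ℂ}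
    {s : ℂ} (hb : ∀ j : Fin q, m ≤ (j : ℕ) → ∀ x, 1 + τ - b j + s + latticePt τ x ≠ 0)
    (ha : ∀ j : Fin p, n ≤ (j : ℕ) → ∀ x, a j - s + latticePt τ x ≠ 0) :
    DifferentiableAt ℂ (fun u => calG m n a b u τ) s := by
  have hd := differentiable_barnesG hτ
  have h1 : ∀ u : ℂ, Differentiable ℂ fun s => barnesG (u - s) τ := fun u =>
    hd.comp (by fun_prop : Differentiable ℂ fun s : ℂ => u - s)
  have h2 : ∀ u : ℂ, Differentiable ℂ fun s => barnesG (u + s) τ := fun u =>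
    hd.comp (by fun_prop : Differentiable ℂ fun s : ℂ => u + s)
  have hprod : ∀ {l : ℕ} (c : Fin l → Prop) [DecidablePred c] (f : Fin l → ℂ → ℂ),
      (∀ j, Differentiable ℂ (f j)) →
      DifferentiableAt ℂ (fun s => ∏ j : Fin l, if c j then f j s else 1) s := by
    intro l c _ f hf
    refine DifferentiableAt.fun_finsetProd fun j _ => ?_
    split_ifs
    · exact hf j s
    · exact differentiableAt_const 1
  unfold calG
  refine DifferentiableAt.fun_div ((hprod _ _ fun j => h1 _).mul (hprod _ _ fun j => h2 _))
    ((hprod _ _ fun j => h2 _).mul (hprod _ _ fun j => h1 _)) (mul_ne_zero ?_ ?_)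
  · refine Finset.prod_ne_zero_iff.2 fun j _ => ?_
    split_ifs with h
    · exact barnesG_ne_zero hτ (hb j h)
    · exact one_ne_zero
  · refine Finset.prod_ne_zero_iff.2 fun j _ => ?_
    split_ifs with h
    · exact barnesG_ne_zero hτ (ha j h)
    · exact one_ne_zero

lemma exists_pos_lt_of_pos {ι : Type*} [Finite ι] (u : ι → ℝ) {ε : ℝ} (hε : 0 < ε) :
    ∃ δ : ℝ, 0 < δ ∧ δ < ε ∧ ∀ j, 0 < u j → δ < u j := by
  have hlt : ∀ {y : ℝ}, 0 < y → ∀ᶠ δ in nhdsWithin (0 : ℝ) (Ioi 0), δ < y := fun hy =>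
    mem_of_superset (Ioo_mem_nhdsGT hy) fun _ h => h.2
  have h : ∀ᶠ δ in nhdsWithin (0 : ℝ) (Ioi 0), 0 < δ ∧ δ < ε ∧ ∀ j, 0 < u j → δ < u j :=
    eventually_mem_nhdsWithin.and ((hlt hε).and (eventually_all.2 fun j =>
      eventually_imp_distrib_left.2 hlt))
  exact h.exists

lemma norm_integral_mul_exp_le (F : ℂ → ℂ) (σ x : ℝ) :
    ‖∫ t : ℝ, F (σ + t * I) * Complex.exp (-((σ + t * I) * x))‖ ≤
      (∫ t : ℝ, ‖F (σ + t * I)‖) * Real.exp (-(σ * x)) := by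
  refine (norm_integral_le_integral_norm _).trans_eq ?_
  rw [← integral_mul_const]
  congr 1
  funext t
  rw [norm_mul, Complex.norm_exp]
  congr 2
  simp

/-- Algebraic asymptotics of the `K`-function as `z → 0⁺`. -/
theorem Kfun_asymptotics_at_zero (τ : ℝ) (hτ : 0 < τ) (α : ℂ) (m n : ℕ) {p q : ℕ}
    (hm : m < q) (hn : n ≤ p) (a : Fin p → ℂ) (b : Fin q → ℂ)
    (hcase : 0 < paramN m n p q ∨ (paramN m n p q = 0 ∧ 0 < α.re))
    (lam : ℝ)
    (hlam_mem : ∃ j : Fin q, m ≤ (j : ℕ) ∧ (b j).re - τ - 1 = lam)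
    (hlam_max : ∀ j : Fin q, m ≤ (j : ℕ) → (b j).re - τ - 1 ≤ lam)
    (hsep : ∀ k : Fin p, n ≤ (k : ℕ) → lam < (a k).re)
    (c : ℝ) (hc1 : lam < c) (hc2 : ∀ k : Fin p, n ≤ (k : ℕ) → c < (a k).re)
    (r : ℕ) (P : Fin r → ℂ) (mOrd : Fin r → ℕ)
    (hinj : Function.Injective P)
    (hPre : ∀ k, (P k).re = lam)
    (hord : ∀ k, 1 ≤ mOrd k)
    (hpole : ∀ k, ∃ g : ℂ → ℂ, AnalyticAt ℂ g (P k) ∧ g (P k) ≠ 0 ∧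
      ∀ᶠ s in nhdsWithin (P k) {P k}ᶜ,
        calG m n a b s (τ : ℂ) = g s / (s - P k) ^ (mOrd k))
    (hall : ∀ s : ℂ, s.re = lam → s ∉ Set.range P →
      AnalyticAt ℂ (fun u : ℂ => calG m n a b u (τ : ℂ)) s) :
    ∃ δ : ℝ, 0 < δ ∧ ∃ A : Fin r → ℕ → ℂ, ∃ M : ℝ, 0 < M ∧
      ∀ z : ℝ, 0 < z → z ≤ 1 →
        ‖KfunZ m n a b (τ : ℂ) α c z
            - ∑ k : Fin r, Complex.exp (-(P k * Real.log z)) *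
                ∑ i ∈ Finset.range (mOrd k), A k i * (Real.log z : ℂ) ^ i‖
          ≤ M * z ^ (-lam + δ) := by
  obtain ⟨δ, hδ0, hδ1, hδu⟩ := exists_pos_lt_of_pos
    (fun j : Fin q => 1 + τ - (b j).re + lam) (lt_min hτ one_pos)
  set F : ℂ → ℂ := fun s => calG m n a b s τ * Complex.exp ((Real.pi : ℂ) * α / τ * s ^ 2) with hF
  obtain ⟨κ, D, T, hκ, hbound⟩ := exists_calG_gaussian_bound hτ α hm.le hn a b hcase (lam - δ) c
  have hexpd : Differentiable ℂ fun s : ℂ => Complex.exp ((Real.pi : ℂ) * α / τ * s ^ 2) := by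
    fun_prop
  have hFd : ∀ s : ℂ, lam - δ ≤ s.re → s.re ≤ c → s ∉ range P → DifferentiableAt ℂ F s := by
    intro s h1 h2 h3
    refine DifferentiableAt.mul ?_ (hexpd s)
    by_cases hs : s.re = lam
    · exact (hall s hs h3).differentiableAt
    refine differentiableAt_calG hτ (fun j hj x h => ?_) (fun j hj x h => ?_)
    · have h4 := congrArg Complex.re h
      simp only [add_re, sub_re, one_re, ofReal_re, zero_re] at h4
      have h5 := hlam_max j hj
      have h6 := latticePt_nonneg hτ x
      rcases lt_or_gt_of_ne hs with h7 | h7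
      · by_cases hu : 0 < 1 + τ - (b j).re + lam
        · linarith [hδu j hu]
        · by_cases hx : x = (0, 0)
          · rw [hx, latticePt_zero] at h4
            linarith
          · linarith [min_le_latticePt hτ hx]
      · linarith
    · have h4 := congrArg Complex.re h
      simp only [add_re, sub_re, ofReal_re, zero_re] at h4
      linarith [hc2 j hj, latticePt_nonneg hτ x]
  have hFpole : ∀ k, ∃ g : ℂ → ℂ, DifferentiableAt ℂ g (P k) ∧
      ∀ᶠ s in nhdsWithin (P k) {P k}ᶜ, F s = g s / (s - P k) ^ mOrd k := by
    intro k
    obtain ⟨g, hg, -, hgF⟩ := hpole k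
    refine ⟨fun s => g s * Complex.exp ((Real.pi : ℂ) * α / τ * s ^ 2),
      hg.differentiableAt.mul (hexpd _), ?_⟩
    filter_upwards [hgF] with s hs
    simp only [hF, hs]
    ring
  obtain ⟨A, hA⟩ := exists_integral_vertical_line_sub_eq_sum (c' := lam - δ) (c := c)
    (by linarith) hinj mOrd (fun k => by rw [hPre k]; exact ⟨by linarith, hc1⟩) hFd hFpole hκ hbound
  have hJ : 0 ≤ ∫ t : ℝ, ‖F ((lam - δ : ℝ) + t * I)‖ := integral_nonneg fun _ => norm_nonneg _
  refine ⟨δ, hδ0, fun k i => 1 / (2 * Real.pi) * A k i,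
    1 / (2 * Real.pi) * (∫ t : ℝ, ‖F ((lam - δ : ℝ) + t * I)‖) + 1, by positivity,
    fun z hz _ => ?_⟩
  have hK : KfunZ m n a b (τ : ℂ) α c z = 1 / (2 * Real.pi) *
      ∫ t : ℝ, F (c + t * I) * Complex.exp (-((c + t * I) * Real.log z)) := by
    have e : ∀ J : ℂ, 1 / (2 * Real.pi * I) * (J * I) = 1 / (2 * Real.pi) * J := by
      intro J
      have := Real.pi_ne_zero
      field_simp
    rw [KfunZ, integral_mul_const, e]
  have hsum : ∑ k : Fin r, Complex.exp (-(P k * Real.log z)) *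
      ∑ i ∈ Finset.range (mOrd k), 1 / (2 * Real.pi) * A k i * (Real.log z : ℂ) ^ i =
      1 / (2 * Real.pi) * ∑ k : Fin r, Complex.exp (-(P k * Real.log z)) *
        ∑ i ∈ Finset.range (mOrd k), A k i * (Real.log z : ℂ) ^ i := by
    simp only [Finset.mul_sum]
    exact Finset.sum_congr rfl fun k _ => Finset.sum_congr rfl fun i _ => by ring
  rw [hsum, ← hA, hK, ← mul_sub, sub_sub_cancel, norm_mul]
  have hn1 : ‖(1 / (2 * Real.pi) : ℂ)‖ = 1 / (2 * Real.pi) := by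
    simp [abs_of_pos Real.pi_pos]
  have hrpow : z ^ (-lam + δ) = Real.exp (-((lam - δ) * Real.log z)) := by
    rw [Real.rpow_def_of_pos hz]
    congr 1; ring
  rw [hn1, hrpow, add_mul, mul_assoc]
  have h1 := mul_le_mul_of_nonneg_left (norm_integral_mul_exp_le F (lam - δ) (Real.log z))
    (by positivity : (0 : ℝ) ≤ 1 / (2 * Real.pi))
  refine h1.trans (le_add_of_nonneg_right (by positivity))
end
end
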